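/- For the independent parallel Gaussian two-level security wiretap channel with L subchannels, gains a_l, b_{1,l}, b_{2,l} (b_{1,l} ≥ b_{2,l} ≥ 0), and average individual per-subchannel power constraints P_1,…,P_L, the rate pair (R1,R2) = ( ∑_{l=1}^L Cs(P_l,a_l,b_{1,l}), ∑_{l=1}^L Cs(P_l,a_l,b_{2,l}) − ∑_{l=1}^L Cs(P_l,a_l,b_{1,l}) ) is achievable; consequently, independent parallel Gaussian two-level security wiretap channels under an average individual per-subchannel power constraint are perfectly embeddable. -/

import Mathlib

open MeasureTheory ProbabilityTheory
open scoped BigOperators ENNReal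
noncomputable section

/-- Kullback–Leibler divergence (in bits) of `μ` from `ν`. -/
def klDivBits {Ω : Type*} [MeasurableSpace Ω] (μ ν : Measure Ω) : ℝ :=
  ∫ ω, Real.logb 2 ((μ.rnDeriv ν ω).toReal) ∂μ

/-- Mutual information (in bits) of a joint law on `α × β`: the KL divergence between the
joint law and the product of its marginals. -/
def miBits {α β : Type*} [MeasurableSpace α] [MeasurableSpace β]
    (μ : Measure (α × β)) : ℝ :=
  klDivBits μ ((μ.map Prod.fst).prod (μ.map Prod.snd))

/-- Law of the outputs of `L` independent parallel memoryless Gaussian channels with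
gains `g l` on the input sequences `xs` (time index first, subchannel index second). -/
def parOut {n L : ℕ} (g : Fin L → ℝ) (xs : Fin n → Fin L → ℝ) :
    Measure (Fin n → Fin L → ℝ) :=
  Measure.pi fun i => Measure.pi fun l => gaussianReal (Real.sqrt (g l) * xs i l) 1

/-- Joint law of the (uniform, independent) message pair and the length-`n` outputs of
the `L` independent parallel Gaussian channels with gains `g`, for the encoder `enc`. -/
def jointLawPar {n L K₁ K₂ : ℕ} (g : Fin L → ℝ)
    (enc : Fin K₁ × Fin K₂ → Measure (Fin n → Fin L → ℝ)) :
    Measure ((Fin K₁ × Fin K₂) × (Fin n → Fin L → ℝ)) :=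
  ((K₁ : ℝ≥0∞) * (K₂ : ℝ≥0∞))⁻¹ •
    Measure.sum fun m : Fin K₁ × Fin K₂ =>
      (Measure.dirac m).prod ((enc m).bind (parOut g))

/-- Achievability of `(R₁,R₂)` for the independent parallel Gaussian two-level security
wiretap channel with legitimate gains `a`, eavesdropper gains `b₁` and `b₂`, under the
input constraint described by the set `PowOK n` (the set of admissible input sequences of
blocklength `n`). -/
def ParAchievable (L : ℕ) (a b₁ b₂ : Fin L → ℝ)
    (PowOK : (n : ℕ) → Set (Fin n → Fin L → ℝ)) (R₁ R₂ : ℝ) : Prop :=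
  ∀ ε > 0, ∃ n : ℕ, 0 < n ∧ ∃ K₁ K₂ : ℕ, 0 < K₁ ∧ 0 < K₂ ∧
    (n : ℝ) * (R₁ - ε) ≤ Real.logb 2 K₁ ∧ (n : ℝ) * (R₂ - ε) ≤ Real.logb 2 K₂ ∧
    ∃ enc : Fin K₁ × Fin K₂ → Measure (Fin n → Fin L → ℝ),
      (∀ m, IsProbabilityMeasure (enc m)) ∧
      (∀ m, enc m (PowOK n) = 1) ∧
      ∃ dec : (Fin n → Fin L → ℝ) → Fin K₁ × Fin K₂, Measurable dec ∧
        (jointLawPar a enc {p | dec p.2 ≠ p.1}).toReal ≤ ε ∧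
        miBits (jointLawPar b₂ enc) ≤ (n : ℝ) * ε ∧
        miBits ((jointLawPar b₁ enc).map fun p => (p.1.1, p.2)) ≤ (n : ℝ) * ε

/-- The average individual per-subchannel power constraint `(1/n) ∑ i, (X_l[i])² ≤ P_l`. -/
def perSubPow (L : ℕ) (P : Fin L → ℝ) : (n : ℕ) → Set (Fin n → Fin L → ℝ) :=
  fun n => {xs | ∀ l, ∑ i, (xs i l) ^ 2 ≤ (n : ℝ) * P l}

/-- The average total power constraint `∑ l, (1/n) ∑ i, (X_l[i])² ≤ P`. -/
def totalPow (L : ℕ) (P : ℝ) : (n : ℕ) → Set (Fin n → Fin L → ℝ) :=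
  fun n => {xs | ∑ l, ∑ i, (xs i l) ^ 2 ≤ (n : ℝ) * P}

/-- The secrecy capacity `Cs(P,a,b)` of the scalar Gaussian wiretap channel. -/
def Cs (P a b : ℝ) : ℝ :=
  max 0 ((1 / 2) * Real.logb 2 (1 + a * P) - (1 / 2) * Real.logb 2 (1 + b * P))

open scoped NNReal



/-! ### Tools for finite product measures -/

theorem lintegral_pi_prod_aux {ι : Type*} [Fintype ι] {Ω : ι → Type*}
    [∀ i, MeasurableSpace (Ω i)] (μ : ∀ i, Measure (Ω i)) [∀ i, IsProbabilityMeasure (μ i)]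
    (f : ∀ i, Ω i → ℝ≥0∞) (hf : ∀ i, Measurable (f i)) :
    ∫⁻ x, ∏ i, f i (x i) ∂(Measure.pi μ) = ∏ i, ∫⁻ x, f i x ∂(μ i) := by
  have h := lintegral_prod_eq_prod_lintegral_of_indepFun (μ := Measure.pi μ) Finset.univ
    (fun i (ω : ∀ i, Ω i) => f i (ω i)) (iIndepFun_pi (fun i => (hf i).aemeasurable))
    (fun i => (hf i).comp (measurable_pi_apply i))
  rw [h]
  refine Finset.prod_congr rfl fun i _ => ?_
  exact (measurePreserving_eval μ i).lintegral_comp (hf i)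

theorem pi_withDensity_aux {ι : Type*} [Fintype ι] {Ω : ι → Type*}
    [∀ i, MeasurableSpace (Ω i)] (μ : ∀ i, Measure (Ω i)) [∀ i, IsProbabilityMeasure (μ i)]
    (f : ∀ i, Ω i → ℝ≥0∞) (hf : ∀ i, Measurable (f i))
    [∀ i, SigmaFinite ((μ i).withDensity (f i))] :
    Measure.pi (fun i => (μ i).withDensity (f i)) =
      (Measure.pi μ).withDensity (fun z => ∏ i, f i (z i)) := by
  apply Measure.pi_eq
  intro s hs
  rw [withDensity_apply _ (MeasurableSet.univ_pi hs), ← lintegral_indicator (MeasurableSet.univ_pi hs)]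
  have : (Set.univ.pi s).indicator (fun z => ∏ i, f i (z i)) =
      fun z => ∏ i, (s i).indicator (f i) (z i) := by
    funext z
    by_cases hz : z ∈ Set.univ.pi s
    · rw [Set.indicator_of_mem hz]
      refine Finset.prod_congr rfl fun i _ => ?_
      rw [Set.indicator_of_mem (hz i (Set.mem_univ i))]
    · rw [Set.indicator_of_notMem hz]
      simp only [Set.mem_pi, Set.mem_univ, true_implies, not_forall] at hz
      obtain ⟨i, hi⟩ := hz
      symm
      exact Finset.prod_eq_zero (Finset.mem_univ i) (Set.indicator_of_notMem hi _)
  rw [this, lintegral_pi_prod_aux μ _ (fun i => (hf i).indicator (hs i))]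
  refine Finset.prod_congr rfl fun i _ => ?_
  rw [lintegral_indicator (hs i), withDensity_apply _ (hs i)]

theorem pi_swap_aux {ι κ : Type*} [Fintype ι] [Fintype κ] {X : Type*} [MeasurableSpace X]
    (μ : ι → κ → Measure X) [∀ i j, IsProbabilityMeasure (μ i j)] :
    Measure.pi (fun i => Measure.pi fun j => μ i j) =
      (Measure.pi (fun j => Measure.pi fun i => μ i j)).map (fun z i j => z j i) := by
  have e1 := Measure.infinitePi_map_curry (fun i j => μ i j)
  have e2 := Measure.infinitePi_map_curry_symm (fun j i => μ i j)
  simp only [Measure.infinitePi_eq_pi] at e1 e2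
  have e3 : Measure.pi (fun p : ι × κ => μ p.1 p.2) =
      (Measure.pi (fun p : κ × ι => μ p.2 p.1)).map (fun z p => z (p.2, p.1)) := by
    apply Measure.pi_eq
    intro s hs
    rw [Measure.map_apply (by fun_prop) (MeasurableSet.univ_pi hs)]
    have : (fun (z : κ × ι → X) (p : ι × κ) => z (p.2, p.1)) ⁻¹' (Set.univ.pi s) =
        Set.univ.pi (fun p : κ × ι => s (p.2, p.1)) := by
      ext z
      simp only [Set.mem_preimage, Set.mem_pi, Set.mem_univ, true_implies]
      exact ⟨fun h p => h (p.2, p.1), fun h p => h (p.2, p.1)⟩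
    rw [this, Measure.pi_pi]
    exact Fintype.prod_equiv (Equiv.prodComm κ ι) _ _ (fun p => rfl)
  rw [← e1, e3, ← e2, Measure.map_map (by fun_prop) (by fun_prop),
    Measure.map_map (by fun_prop) (by fun_prop)]
  rfl

/-- Uniform average of a finite family of measures. -/
def avgM {ι Ω : Type*} [Fintype ι] [MeasurableSpace Ω] (ν : ι → Measure Ω) : Measure Ω :=
  (Fintype.card ι : ℝ≥0∞)⁻¹ • Measure.sum ν

theorem avgM_apply {ι Ω : Type*} [Fintype ι] [MeasurableSpace Ω] (ν : ι → Measure Ω)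
    (s : Set Ω) : avgM ν s = (Fintype.card ι : ℝ≥0∞)⁻¹ * ∑ i, ν i s := by
  simp [avgM, Measure.sum_fintype]

theorem lintegral_avgM {ι Ω : Type*} [Fintype ι] [MeasurableSpace Ω] (ν : ι → Measure Ω)
    (f : Ω → ℝ≥0∞) : ∫⁻ x, f x ∂(avgM ν) = (Fintype.card ι : ℝ≥0∞)⁻¹ * ∑ i, ∫⁻ x, f x ∂(ν i) := by
  rw [avgM, lintegral_smul_measure, lintegral_sum_measure, tsum_fintype, smul_eq_mul]

instance avgM_prob {ι Ω : Type*} [Fintype ι] [Nonempty ι] [MeasurableSpace Ω] (ν : ι → Measure Ω)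
    [∀ i, IsProbabilityMeasure (ν i)] : IsProbabilityMeasure (avgM ν) := by
  constructor
  rw [avgM_apply]
  simp only [measure_univ, Finset.sum_const, Finset.card_univ, nsmul_eq_mul, mul_one]
  exact ENNReal.inv_mul_cancel (by simp) (by simp)

theorem avgM_equiv {ι κ Ω : Type*} [Fintype ι] [Fintype κ] [MeasurableSpace Ω] (e : ι ≃ κ)
    (ν : κ → Measure Ω) : avgM (fun i => ν (e i)) = avgM ν := by
  ext s _
  rw [avgM_apply, avgM_apply, Fintype.card_congr e, Equiv.sum_comp e (fun i => ν i s)]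

theorem avgM_prod {ι κ Ω : Type*} [Fintype ι] [Fintype κ] [MeasurableSpace Ω]
    (ν : ι → κ → Measure Ω) : avgM (fun i => avgM (ν i)) = avgM (fun p : ι × κ => ν p.1 p.2) := by
  ext s _
  simp only [avgM_apply, Fintype.card_prod, Fintype.sum_prod_type, ← Finset.mul_sum, Nat.cast_mul]
  rw [← mul_assoc, ENNReal.mul_inv]
  · right; simp
  · left; simp

theorem avgM_map {ι Ω Ω' : Type*} [Fintype ι] [MeasurableSpace Ω] [MeasurableSpace Ω']
    (ν : ι → Measure Ω) (f : Ω → Ω') (hf : Measurable f) :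
    (avgM ν).map f = avgM (fun i => (ν i).map f) := by
  ext s hs
  rw [Measure.map_apply hf hs, avgM_apply, avgM_apply]
  simp only [Measure.map_apply hf hs]

theorem prod_avg_aux {ι : Type*} [Fintype ι] [DecidableEq ι] {κ : ι → Type*} [∀ i, Fintype (κ i)]
    (f : ∀ i, κ i → ℝ≥0∞) :
    ∏ i, ((Fintype.card (κ i) : ℝ≥0∞)⁻¹ * ∑ k, f i k) =
      (Fintype.card (∀ i, κ i) : ℝ≥0∞)⁻¹ * ∑ k : ∀ i, κ i, ∏ i, f i (k i) := by
  rw [Finset.prod_mul_distrib, Finset.prod_univ_sum, Fintype.piFinset_univ]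
  congr 1
  rw [Fintype.card_pi, Nat.cast_prod, ENNReal.prod_inv_distrib]
  intro i _ j _ _
  right; simp

theorem pi_avgM {ι : Type*} [Fintype ι] [DecidableEq ι] {κ : ι → Type*} [∀ i, Fintype (κ i)]
    [∀ i, Nonempty (κ i)]
    {Ω : ι → Type*} [∀ i, MeasurableSpace (Ω i)] (ν : ∀ i, κ i → Measure (Ω i))
    [∀ i k, IsProbabilityMeasure (ν i k)] :
    Measure.pi (fun i => avgM (ν i)) = avgM (fun k : ∀ i, κ i => Measure.pi fun i => ν i (k i)) := by
  apply Measure.pi_eq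
  intro s hs
  simp only [avgM_apply, Measure.pi_pi]
  rw [prod_avg_aux]

/-- averaging a function of one coordinate -/
theorem avg_coord_aux {ι : Type*} [Fintype ι] [DecidableEq ι] {κ : ι → Type*} [∀ i, Fintype (κ i)]
    [∀ i, Nonempty (κ i)] (j : ι) (f : κ j → ℝ≥0∞) :
    (Fintype.card (∀ i, κ i) : ℝ≥0∞)⁻¹ * ∑ k : ∀ i, κ i, f (k j) =
      (Fintype.card (κ j) : ℝ≥0∞)⁻¹ * ∑ k, f k := by
  let F : ∀ i, κ i → ℝ≥0∞ := fun i k => if h : i = j then f (h ▸ k) else 1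
  have h1 : ∀ k : ∀ i, κ i, ∏ i, F i (k i) = f (k j) := by
    intro k
    rw [Finset.prod_eq_single j]
    · simp [F]
    · intro b _ hb; simp [F, hb]
    · simp
  have h2 := prod_avg_aux F
  simp only [h1] at h2
  rw [← h2, Finset.prod_eq_single j]
  · simp [F]
  · intro b _ hb
    simp only [F, hb, dite_false, Finset.sum_const, Finset.card_univ, nsmul_eq_mul, mul_one]
    exact ENNReal.inv_mul_cancel (by simp) (by simp)
  · simp

theorem cheb_aux {Ω : Type*} [MeasurableSpace Ω] (μ : Measure Ω) [IsProbabilityMeasure μ]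
    (f : Ω → ℝ) (hf : MemLp f 2 μ) (n : ℕ) :
    ∫⁻ x, ENNReal.ofReal |∑ i, f (x i) - n * ∫ y, f y ∂μ| ∂(Measure.pi fun _ : Fin n => μ) ≤
      ENNReal.ofReal (√n * √(Var[f; μ])) := by
  set ν := Measure.pi fun _ : Fin n => μ with hν
  have hS : MemLp (∑ i, fun x : Fin n → Ω => f (x i)) 2 ν :=
    memLp_finsetSum' _ fun i _ => hf.comp_measurePreserving (measurePreserving_eval (fun _ : Fin n => μ) i)
  set S := ∑ i, fun x : Fin n → Ω => f (x i) with hSdef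
  have hSx : ∀ x, S x = ∑ i, f (x i) := fun x => by simp [S]
  have hvar : Var[S; ν] = n * Var[f; μ] := by
    have := variance_sum_pi (μ := fun _ : Fin n => μ) (X := fun _ => f) (fun _ => hf)
    simpa using this
  have hitg : Integrable S ν := hS.integrable (by norm_num)
  have hmean : ∫ x, S x ∂ν = n * ∫ y, f y ∂μ := by
    simp only [hSx]
    rw [integral_finsetSum]
    · have : ∀ i : Fin n, ∫ x, f (x i) ∂ν = ∫ y, f y ∂μ := by
        intro i
        have hm := measurePreserving_eval (fun _ : Fin n => μ) i
        have h3 := integral_map (μ := ν) (φ := Function.eval i) (f := f) hm.measurable.aemeasurable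
          (by rw [hm.map_eq]; exact hf.1)
        rw [hm.map_eq] at h3
        exact h3.symm
      simp [this]
    · intro i _
      exact ((hf.comp_measurePreserving (measurePreserving_eval (fun _ : Fin n => μ) i))).integrable (by norm_num)
  have hD : MemLp (fun x => S x - ν[S]) 2 ν := hS.sub (memLp_const _)
  have h4 : ∫ x, |S x - ν[S]| ∂ν ≤ √(Var[S; ν]) := by
    apply Real.le_sqrt_of_sq_le
    rw [variance_eq_integral hS.1.aemeasurable]
    have hA : MemLp (fun x => |S x - ν[S]|) 2 ν := hD.abs
    have := variance_nonneg (fun x => |S x - ν[S]|) ν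
    rw [variance_eq_sub hA] at this
    simp only [Pi.pow_apply, sq_abs] at this
    linarith
  rw [← hmean]
  simp only [← hSx]
  rw [← ofReal_integral_eq_lintegral_ofReal (hD.integrable (by norm_num)).abs
    (Filter.Eventually.of_forall fun x => abs_nonneg _)]
  apply ENNReal.ofReal_le_ofReal
  rw [← Real.sqrt_mul (by positivity), ← hvar]
  exact h4



/-! ### Leakage bounds -/

def ell (t : ℝ≥0) : ℝ≥0∞ := ENNReal.ofReal (Real.log (1 + t))

theorem measurable_ell : Measurable ell := by
  unfold ell; fun_prop

theorem measurable_ell_comp {Ω : Type*} [MeasurableSpace Ω] {f : Ω → ℝ≥0} (hf : Measurable f) :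
    Measurable fun x => ell (f x) := measurable_ell.comp hf

/-- `V m` have densities `R m` with respect to a common reference probability law, and the average
of `∫ log (1 + R m) ∂V m` is at most `t`. -/
def Leak {M Z : Type*} [Fintype M] [MeasurableSpace Z] (V : M → Measure Z) (t : ℝ≥0∞) : Prop :=
  ∃ Q : Measure Z, IsProbabilityMeasure Q ∧ ∃ R : M → Z → ℝ≥0, (∀ m, Measurable (R m)) ∧
    (∀ m, V m = Q.withDensity (fun z => (R m z : ℝ≥0∞))) ∧
    (Fintype.card M : ℝ≥0∞)⁻¹ * ∑ m, ∫⁻ z, ell (R m z) ∂(V m) ≤ t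

theorem Leak.mono {M Z : Type*} [Fintype M] [MeasurableSpace Z] {V : M → Measure Z} {t t' : ℝ≥0∞}
    (h : Leak V t) (htt : t ≤ t') : Leak V t' := by
  obtain ⟨Q, hQ, R, h1, h2, h3⟩ := h
  exact ⟨Q, hQ, R, h1, h2, h3.trans htt⟩

theorem leak_const {M Z : Type*} [Fintype M] [Nonempty M] [MeasurableSpace Z] (V : M → Measure Z)
    (Q : Measure Z) [IsProbabilityMeasure Q] (h : ∀ m, V m = Q) :
    Leak V (ENNReal.ofReal (Real.log 2)) := by
  refine ⟨Q, inferInstance, fun _ _ => 1, fun _ => measurable_const, fun m => ?_, ?_⟩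
  · simp [h m]
  · have : (1 : ℝ) + 1 = 2 := by norm_num
    simp only [h, ell, NNReal.coe_one, this, lintegral_const, measure_univ, mul_one,
      Finset.sum_const, Finset.card_univ, nsmul_eq_mul]
    rw [← mul_assoc, ENNReal.inv_mul_cancel (by simp) (by simp), one_mul]

theorem Leak.reindex {M M' Z : Type*} [Fintype M] [Fintype M'] [MeasurableSpace Z]
    {V : M → Measure Z} {t : ℝ≥0∞} (h : Leak V t) (e : M' ≃ M) : Leak (fun m => V (e m)) t := by
  obtain ⟨Q, hQ, R, h1, h2, h3⟩ := h
  refine ⟨Q, hQ, fun m => R (e m), fun m => h1 _, fun m => h2 _, ?_⟩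
  rw [Fintype.card_congr e, Equiv.sum_comp e (fun m => ∫⁻ z, ell (R m z) ∂(V m))]
  exact h3

theorem Leak.map {M Z Z' : Type*} [Fintype M] [MeasurableSpace Z] [MeasurableSpace Z']
    {V : M → Measure Z} {t : ℝ≥0∞} (h : Leak V t) (f : Z → Z') (g : Z' → Z) (hf : Measurable f)
    (hg : Measurable g) (hgf : ∀ z, g (f z) = z) :
    Leak (fun m => (V m).map f) t := by
  obtain ⟨Q, hQ, R, h1, h2, h3⟩ := h
  refine ⟨Q.map f, Measure.isProbabilityMeasure_map hf.aemeasurable, fun m z => R m (g z),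
    fun m => (h1 m).comp hg, fun m => ?_, ?_⟩
  · ext s hs
    rw [Measure.map_apply hf hs, h2 m, withDensity_apply _ (hf hs), withDensity_apply _ hs,
      setLIntegral_map hs (by have := h1 m; fun_prop) hf]
    simp [hgf]
  · refine le_trans (le_of_eq ?_) h3
    congr 1
    refine Finset.sum_congr rfl fun m _ => ?_
    have := lintegral_map (μ := V m) (measurable_ell_comp ((h1 m).comp hg)) hf
    simpa [hgf] using this

theorem ell_prod_le {ι : Type*} [Fintype ι] (r : ι → ℝ≥0) :
    ell (∏ i, r i) ≤ ENNReal.ofReal (Real.log 2) + ∑ i, ell (r i) := by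
  unfold ell
  rw [← ENNReal.ofReal_sum_of_nonneg (fun i _ => Real.log_nonneg (by simp)),
    ← ENNReal.ofReal_add (Real.log_nonneg (by norm_num))
      (Finset.sum_nonneg fun i _ => Real.log_nonneg (by simp))]
  apply ENNReal.ofReal_le_ofReal
  have h1 : (1 : ℝ) ≤ ∏ i, (1 + (r i : ℝ)) := Finset.one_le_prod fun i => by simp
  have h2 : ∏ i, (r i : ℝ) ≤ ∏ i, (1 + (r i : ℝ)) :=
    Finset.prod_le_prod (fun i _ => by positivity) fun i _ => by simp
  rw [← Real.log_prod (fun i _ => by positivity), ← Real.log_mul (by norm_num) (by positivity)]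
  apply Real.log_le_log (by positivity)
  rw [NNReal.coe_prod]
  linarith

theorem Leak.pi {ι : Type*} [Fintype ι] [DecidableEq ι] {M : ι → Type*} [∀ i, Fintype (M i)]
    [∀ i, Nonempty (M i)] {Z : ι → Type*} [∀ i, MeasurableSpace (Z i)]
    {V : ∀ i, M i → Measure (Z i)} [∀ i m, IsProbabilityMeasure (V i m)] {t : ι → ℝ≥0∞}
    (h : ∀ i, Leak (V i) (t i)) :
    Leak (fun m : ∀ i, M i => Measure.pi fun i => V i (m i))
      (ENNReal.ofReal (Real.log 2) + ∑ i, t i) := by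
  choose Q hQ R h1 h2 h3 using h
  refine ⟨Measure.pi Q, inferInstance, fun m z => ∏ i, R i (m i) (z i), fun m => ?_, fun m => ?_, ?_⟩
  · exact Finset.measurable_prod _ fun i _ => (h1 i (m i)).comp (measurable_pi_apply i)
  · have : ∀ i, IsProbabilityMeasure ((Q i).withDensity fun z => (R i (m i) z : ℝ≥0∞)) := by
      intro i; rw [← h2]; infer_instance
    simp only [h2]
    rw [pi_withDensity_aux Q (fun i z => (R i (m i) z : ℝ≥0∞))
      (fun i => (h1 i (m i)).coe_nnreal_ennreal)]
    simp
  · have hb : ∀ m : ∀ i, M i, ∫⁻ z, ell (∏ i, R i (m i) (z i)) ∂(Measure.pi fun i => V i (m i)) ≤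
        ENNReal.ofReal (Real.log 2) + ∑ i, ∫⁻ z, ell (R i (m i) z) ∂(V i (m i)) := by
      intro m
      refine (lintegral_mono fun z => ell_prod_le _).trans ?_
      rw [lintegral_add_left measurable_const, lintegral_finsetSum _
        (f := fun i (z : ∀ i, Z i) => ell (R i (m i) (z i)))
        (fun i _ => measurable_ell_comp ((h1 i (m i)).comp (measurable_pi_apply i)))]
      simp only [lintegral_const, measure_univ, mul_one]
      refine le_of_eq (congrArg _ (Finset.sum_congr rfl fun i _ => ?_))
      exact (measurePreserving_eval (fun i => V i (m i)) i).lintegral_comp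
        (measurable_ell.comp (h1 i (m i)))
    refine (mul_le_mul_right (Finset.sum_le_sum fun m _ => hb m) _).trans ?_
    rw [Finset.sum_add_distrib, mul_add]
    apply add_le_add
    · rw [Finset.sum_const, Finset.card_univ, nsmul_eq_mul, ← mul_assoc,
        ENNReal.inv_mul_cancel (Nat.cast_ne_zero.mpr Fintype.card_ne_zero)
          (ENNReal.natCast_ne_top _), one_mul]
    rw [Finset.sum_comm, Finset.mul_sum]
    refine Finset.sum_le_sum fun i _ => ?_
    rw [avg_coord_aux i (fun k => ∫⁻ z, ell (R i k z) ∂(V i k))]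
    exact h3 i

theorem integral_le_of_lintegral {Ω : Type*} [MeasurableSpace Ω] (μ : Measure Ω) (f : Ω → ℝ)
    (B : ℝ≥0∞) (hB : B ≠ ⊤) (h : ∫⁻ x, ENNReal.ofReal (f x) ∂μ ≤ B) : ∫ x, f x ∂μ ≤ B.toReal := by
  by_cases hi : Integrable f μ
  · rw [integral_eq_lintegral_pos_part_sub_lintegral_neg_part hi]
    have := ENNReal.toReal_mono hB h
    have := ENNReal.toReal_nonneg (a := ∫⁻ a, ENNReal.ofReal (-f a) ∂μ)
    linarith
  · rw [integral_undef hi]; exact ENNReal.toReal_nonneg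

theorem pointwise_log_aux (R p : ℝ≥0) : Real.log ((R / p : ℝ≥0) : ℝ) ≤ Real.log (1 + R) + (p⁻¹ : ℝ≥0) := by
  have h0 : 0 ≤ Real.log (1 + R) := Real.log_nonneg (by simp)
  have h1 : (0 : ℝ) ≤ (p⁻¹ : ℝ≥0) := NNReal.coe_nonneg _
  rcases eq_or_ne R 0 with rfl | hR
  · simp
  rcases eq_or_ne p 0 with rfl | hp
  · simpa using h0
  rw [div_eq_mul_inv, NNReal.coe_mul, Real.log_mul (by simpa using hR) (by simpa using hp)]
  have hR' : (0 : ℝ) < R := by positivity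
  have hp' : (0 : ℝ) < (p⁻¹ : ℝ≥0) := by positivity
  have := Real.log_le_log hR' (by linarith : (R : ℝ) ≤ 1 + R)
  have := Real.log_le_sub_one_of_pos hp'
  linarith

/-- joint law of a uniform message and the output -/
def jointM {M Z : Type*} [Fintype M] [MeasurableSpace M] [MeasurableSpace Z]
    (V : M → Measure Z) : Measure (M × Z) :=
  avgM fun m => (Measure.dirac m).prod (V m)

theorem miBits_le_of_leak {M Z : Type*} [Fintype M] [Nonempty M] [MeasurableSpace M]
    [MeasurableSingletonClass M] [MeasurableSpace Z]
    (V : M → Measure Z) [∀ m, IsProbabilityMeasure (V m)] (t : ℝ≥0∞) (ht : t ≠ ⊤) (h : Leak V t) :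
    miBits (jointM V) ≤ (t.toReal + 1) / Real.log 2 := by
  obtain ⟨Q, hQ, R, h1, h2, h3⟩ := h
  have hcard : (Fintype.card M : ℝ≥0∞) ≠ 0 := by simp
  set U : Measure M := avgM Measure.dirac with hU
  have hfst : (jointM V).map Prod.fst = U := by
    rw [jointM, avgM_map _ _ measurable_fst, hU]
    simp
  have hsnd : (jointM V).map Prod.snd = avgM V := by
    rw [jointM, avgM_map _ _ measurable_snd]
    simp
  set p : Z → ℝ≥0 := fun z => (Fintype.card M : ℝ≥0)⁻¹ * ∑ m, R m z with hp
  have hpm : Measurable p := by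
    have : Measurable fun z => ∑ m, R m z := Finset.measurable_sum _ fun m _ => h1 m
    fun_prop
  have hpE : ∀ z, (p z : ℝ≥0∞) = (Fintype.card M : ℝ≥0∞)⁻¹ * ∑ m, (R m z : ℝ≥0∞) := by
    intro z
    simp only [hp]
    rw [ENNReal.coe_mul, ENNReal.coe_inv (by simp)]
    simp
  have hP : avgM V = Q.withDensity (fun z => (p z : ℝ≥0∞)) := by
    ext s hs
    rw [avgM_apply, withDensity_apply _ hs]
    simp only [h2, withDensity_apply _ hs, hpE]
    rw [lintegral_const_mul _ (Finset.measurable_sum _ fun m _ => (h1 m).coe_nnreal_ennreal),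
      lintegral_finsetSum _ (fun m _ => (h1 m).coe_nnreal_ennreal)]
  have hRm : Measurable (fun x : M × Z => R x.1 x.2) := measurable_from_prod_countable_right h1
  have hjoint : jointM V = (U.prod Q).withDensity (fun x => (R x.1 x.2 : ℝ≥0∞)) := by
    have hUQ : ∀ f : M × Z → ℝ≥0∞, Measurable f → ∫⁻ x, f x ∂(U.prod Q) =
        (Fintype.card M : ℝ≥0∞)⁻¹ * ∑ m, ∫⁻ z, f (m, z) ∂Q := by
      intro f hf
      rw [lintegral_prod _ hf.aemeasurable, hU, lintegral_avgM]
      simp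
    ext s hs
    rw [withDensity_apply _ hs, ← lintegral_indicator hs, hUQ _ (hRm.coe_nnreal_ennreal.indicator hs),
      jointM, avgM_apply]
    congr 1
    refine Finset.sum_congr rfl fun m _ => ?_
    rw [Measure.dirac_prod, Measure.map_apply measurable_prodMk_left hs, h2 m,
      withDensity_apply _ (measurable_prodMk_left hs), ← lintegral_indicator (measurable_prodMk_left hs)]
    rfl
  set f : M × Z → ℝ≥0 := fun x => R x.1 x.2 / p x.2 with hf
  have hfm : Measurable f := hRm.div (hpm.comp measurable_snd)
  have hUp : IsProbabilityMeasure U := by rw [hU]; infer_instance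
  have hPp : IsProbabilityMeasure (avgM V) := inferInstance
  have hwd : jointM V = (U.prod (avgM V)).withDensity (fun x => (f x : ℝ≥0∞)) := by
    have : SFinite (Q.withDensity (fun z => (p z : ℝ≥0∞))) := by rw [← hP]; infer_instance
    rw [hP, prod_withDensity_right hpm.coe_nnreal_ennreal, ← withDensity_mul _
      (f := fun z : M × Z => (p z.2 : ℝ≥0∞)) (hpm.coe_nnreal_ennreal.comp measurable_snd) hfm.coe_nnreal_ennreal, hjoint]
    congr 1
    funext x
    simp only [Pi.mul_apply, ← ENNReal.coe_mul, hf]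
    congr 1
    by_cases h0 : p x.2 = 0
    · have : R x.1 x.2 = 0 := by
        simp only [hp, mul_eq_zero, inv_eq_zero, Nat.cast_eq_zero, Fintype.card_ne_zero, false_or,
          Finset.sum_eq_zero_iff] at h0
        exact h0 _ (Finset.mem_univ _)
      simp [this]
    · field_simp
  have hae : (jointM V).rnDeriv (U.prod (avgM V)) =ᵐ[jointM V] fun x => (f x : ℝ≥0∞) := by
    have hac : jointM V ≪ U.prod (avgM V) := by
      conv_lhs => rw [hwd]
      exact withDensity_absolutelyContinuous _ _
    apply hac.ae_le
    have := Measure.rnDeriv_withDensity (U.prod (avgM V)) hfm.coe_nnreal_ennreal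
    rwa [← hwd] at this
  unfold miBits klDivBits
  rw [hfst, hsnd]
  have e1 : ∫ x, Real.logb 2 (((jointM V).rnDeriv (U.prod (avgM V)) x).toReal) ∂(jointM V) =
      (∫ x, Real.log (f x) ∂(jointM V)) / Real.log 2 := by
    rw [← integral_div]
    apply integral_congr_ae
    filter_upwards [hae] with x hx
    rw [hx]; simp [Real.logb]
  rw [e1]
  have hl2 : 0 < Real.log 2 := Real.log_pos (by norm_num)
  apply div_le_div_of_nonneg_right _ hl2.le
  have e2 : t.toReal + 1 = (t + 1).toReal := by rw [ENNReal.toReal_add ht (by simp)]; simp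
  rw [e2]
  apply integral_le_of_lintegral _ _ _ (by simp [ht])
  have e3 : ∀ x : M × Z, ENNReal.ofReal (Real.log (f x)) ≤ ell (R x.1 x.2) + ((p x.2)⁻¹ : ℝ≥0) := by
    intro x
    refine (ENNReal.ofReal_le_ofReal (pointwise_log_aux _ _)).trans ?_
    refine ENNReal.ofReal_add_le.trans ?_
    rw [ENNReal.ofReal_coe_nnreal]; rfl
  refine (lintegral_mono e3).trans ?_
  rw [lintegral_add_left (measurable_ell_comp hRm)]
  apply add_le_add
  · rw [jointM, lintegral_avgM]
    refine le_trans (le_of_eq ?_) h3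
    congr 1
    refine Finset.sum_congr rfl fun m _ => ?_
    rw [Measure.dirac_prod, lintegral_map (measurable_ell_comp hRm) measurable_prodMk_left]
  · have e4 : ∫⁻ x, (((p x.2)⁻¹ : ℝ≥0) : ℝ≥0∞) ∂(jointM V) = ∫⁻ z, (((p z)⁻¹ : ℝ≥0) : ℝ≥0∞) ∂(avgM V) := by
      rw [← hsnd, lintegral_map (by fun_prop) measurable_snd]
    rw [e4, hP, lintegral_withDensity_eq_lintegral_mul _ hpm.coe_nnreal_ennreal (by fun_prop)]
    calc _ ≤ ∫⁻ z, 1 ∂Q := by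
          apply lintegral_mono
          intro z
          simp only [Pi.mul_apply, ← ENNReal.coe_mul]
          by_cases h0 : p z = 0
          · simp [h0]
          · simp [mul_inv_cancel₀ h0]
      _ = 1 := by simp



/-! ### Random coding -/

theorem lintegral_pi_single {J X : Type*} [Fintype J] [MeasurableSpace X] (p : Measure X)
    [IsProbabilityMeasure p] (j : J) (f : X → ℝ≥0∞) (hf : Measurable f) :
    ∫⁻ c, f (c j) ∂(Measure.pi fun _ : J => p) = ∫⁻ x, f x ∂p :=
  (measurePreserving_eval (fun _ : J => p) j).lintegral_comp hf

theorem lintegral_pi_pair {J X : Type*} [Fintype J] [MeasurableSpace X] (p : Measure X)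
    [IsProbabilityMeasure p] (j k : J) (hjk : j ≠ k) (f g : X → ℝ≥0∞) (hf : Measurable f)
    (hg : Measurable g) :
    ∫⁻ c, f (c j) * g (c k) ∂(Measure.pi fun _ : J => p) = (∫⁻ x, f x ∂p) * ∫⁻ x, g x ∂p := by
  have hi : IndepFun (fun c : J → X => c j) (fun c : J → X => c k) (Measure.pi fun _ : J => p) :=
    (iIndepFun_pi (μ := fun _ : J => p) (X := fun _ x => x) (fun _ => aemeasurable_id)).indepFun hjk
  have hi2 := hi.comp hf hg
  have := lintegral_mul_eq_lintegral_mul_lintegral_of_indepFun''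
    (hf.comp (measurable_pi_apply j)).aemeasurable (hg.comp (measurable_pi_apply k)).aemeasurable hi2
  simp only [Function.comp] at this
  rw [this, lintegral_pi_single p j f hf, lintegral_pi_single p k g hg]

/-- A channel, given by densities `r x` with respect to a reference output law `Q`, such that the
output law under input `p` has density at most `2`. -/
structure Chan {X Z : Type*} [MeasurableSpace X] [MeasurableSpace Z] (p : Measure X)
    (Q : Measure Z) (r : X → Z → ℝ≥0) : Prop where
  meas : Measurable (fun q : X × Z => r q.1 q.2)
  int1 : ∀ x, ∫⁻ z, r x z ∂Q = 1
  mix : ∀ᵐ z ∂Q, ∫⁻ x, r x z ∂p ≤ 2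

theorem ell_split (u v : ℝ≥0) : ell (u + v) ≤ ell u + v := by
  unfold ell
  have hv : (v : ℝ≥0∞) = ENNReal.ofReal v := by simp
  rw [hv, ← ENNReal.ofReal_add (Real.log_nonneg (by simp)) (by simp)]
  apply ENNReal.ofReal_le_ofReal
  have h1 : (1 : ℝ) + ((u + v : ℝ≥0) : ℝ) ≤ (1 + u) * (1 + v) := by
    push_cast
    nlinarith [u.2, v.2, mul_nonneg u.2 v.2]
  have h2 : Real.log (1 + (v : ℝ)) ≤ v := by
    have := Real.log_le_sub_one_of_pos (by positivity : (0 : ℝ) < 1 + v)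
    linarith
  calc Real.log (1 + ((u + v : ℝ≥0) : ℝ)) ≤ Real.log ((1 + u) * (1 + v)) :=
        Real.log_le_log (by positivity) h1
    _ = Real.log (1 + u) + Real.log (1 + v) := Real.log_mul (by positivity) (by positivity)
    _ ≤ _ := by linarith

/-- The mixture density. -/
def mixR {X Z W : Type*} [Fintype W] (r : X → Z → ℝ≥0) (d : W → X) (z : Z) : ℝ≥0 :=
  (Fintype.card W : ℝ≥0)⁻¹ * ∑ w, r (d w) z

theorem mix_pointwise {X Z W : Type*} [Fintype W] [Nonempty W] [DecidableEq W]
    (r : X → Z → ℝ≥0) (d : W → X) (z : Z) :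
    (mixR r d z : ℝ≥0∞) * ell (mixR r d z) ≤
      (Fintype.card W : ℝ≥0∞)⁻¹ * ∑ w, (r (d w) z * ell (r (d w) z / Fintype.card W) +
        (Fintype.card W : ℝ≥0∞)⁻¹ * ∑ w' ∈ Finset.univ.erase w, (r (d w) z : ℝ≥0∞) * r (d w') z) := by
  have h1 : (mixR r d z : ℝ≥0∞) = (Fintype.card W : ℝ≥0∞)⁻¹ * ∑ w, (r (d w) z : ℝ≥0∞) := by
    unfold mixR
    rw [ENNReal.coe_mul, ENNReal.coe_inv (by simp)]
    simp
  rw [h1, mul_assoc, Finset.sum_mul]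
  gcongr with w _
  have h2 : mixR r d z = r (d w) z / Fintype.card W +
      (Fintype.card W : ℝ≥0)⁻¹ * ∑ w' ∈ Finset.univ.erase w, r (d w') z := by
    unfold mixR
    rw [← Finset.add_sum_erase _ _ (Finset.mem_univ w), mul_add, div_eq_inv_mul]
  rw [h2]
  refine (mul_le_mul_right (ell_split _ _) _).trans ?_
  rw [mul_add]
  refine add_le_add le_rfl (le_of_eq ?_)
  rw [ENNReal.coe_mul, ENNReal.coe_inv (by simp)]
  simp only [ENNReal.coe_natCast, ENNReal.ofNNReal_finsetSum, ← Finset.mul_sum]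
  rw [mul_left_comm]

theorem card_inv_mul_sum_const {W : Type*} [Fintype W] [Nonempty W] (a : ℝ≥0∞) :
    (Fintype.card W : ℝ≥0∞)⁻¹ * ∑ _w : W, a = a := by
  rw [Finset.sum_const, Finset.card_univ, nsmul_eq_mul, ← mul_assoc,
    ENNReal.inv_mul_cancel (Nat.cast_ne_zero.mpr Fintype.card_ne_zero)
      (ENNReal.natCast_ne_top _), one_mul]

theorem measurable_mixR_joint {X Z W J : Type*} [Fintype W] [MeasurableSpace X] [MeasurableSpace Z]
    {r : X → Z → ℝ≥0} (hr : Measurable (fun q : X × Z => r q.1 q.2)) (φ : W → J) :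
    Measurable (fun q : (J → X) × Z => mixR r (fun w => q.1 (φ w)) q.2) := by
  unfold mixR
  have : ∀ w, Measurable (fun q : (J → X) × Z => r (q.1 (φ w)) q.2) := by
    intro w
    have h1 : Measurable (fun q : (J → X) × Z => (q.1 (φ w), q.2)) := by fun_prop
    exact hr.comp h1
  have h2 : Measurable (fun q : (J → X) × Z => ∑ w, r (q.1 (φ w)) q.2) :=
    Finset.measurable_sum _ fun w _ => this w
  exact measurable_const.mul h2

theorem resolv {X Z J W : Type*} [MeasurableSpace X] [MeasurableSpace Z] [Fintype J] [Fintype W]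
    [Nonempty W] (p : Measure X) [IsProbabilityMeasure p] (Q : Measure Z) [IsProbabilityMeasure Q]
    (r : X → Z → ℝ≥0) (h : Chan p Q r) (φ : W → J) (hφ : Function.Injective φ) :
    ∫⁻ c, ∫⁻ z, (mixR r (fun w => c (φ w)) z : ℝ≥0∞) * ell (mixR r (fun w => c (φ w)) z) ∂Q
      ∂(Measure.pi fun _ : J => p) ≤
    (∫⁻ x, ∫⁻ z, r x z * ell (r x z / Fintype.card W) ∂Q ∂p) + 2 := by
  classical
  have hm := measurable_mixR_joint h.meas φ
  have hrz : ∀ z, Measurable fun x => r x z := fun z => h.meas.comp (measurable_id.prodMk measurable_const)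
  have hre : Measurable (fun q : X × Z => (r q.1 q.2 : ℝ≥0∞)) := h.meas.coe_nnreal_ennreal
  have hG : Measurable (fun q : X × Z => (r q.1 q.2 : ℝ≥0∞) * ell (r q.1 q.2 / Fintype.card W)) :=
    hre.mul (measurable_ell_comp (h.meas.div_const _))
  have hsw := lintegral_lintegral_swap (μ := Measure.pi fun _ : J => p) (ν := Q)
    (f := fun c z => (mixR r (fun w => c (φ w)) z : ℝ≥0∞) * ell (mixR r (fun w => c (φ w)) z))
    ((Measurable.mul (f := fun q : (J → X) × Z => (mixR r (fun w => q.1 (φ w)) q.2 : ℝ≥0∞))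
      hm.coe_nnreal_ennreal (measurable_ell_comp hm)).aemeasurable)
  rw [hsw]
  have key : ∀ z, ∫⁻ c, (mixR r (fun w => c (φ w)) z : ℝ≥0∞) * ell (mixR r (fun w => c (φ w)) z)
      ∂(Measure.pi fun _ : J => p) ≤
      (∫⁻ x, r x z * ell (r x z / Fintype.card W) ∂p) + (∫⁻ x, r x z ∂p) * ∫⁻ x, r x z ∂p := by
    intro z
    have hpt := fun c : J → X => mix_pointwise r (fun w => c (φ w)) z
    refine (lintegral_mono hpt).trans ?_
    clear hpt
    have hGz : Measurable (fun x => (r x z : ℝ≥0∞) * ell (r x z / Fintype.card W)) :=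
      hG.comp (measurable_id.prodMk measurable_const)
    have hrze : Measurable fun x => (r x z : ℝ≥0∞) := (hrz z).coe_nnreal_ennreal
    have m1 : ∀ w : W, Measurable fun c : J → X => (r (c (φ w)) z : ℝ≥0∞) := fun w =>
      hrze.comp (measurable_pi_apply (φ w))
    have m2 : ∀ w : W, Measurable fun c : J → X =>
        (r (c (φ w)) z : ℝ≥0∞) * ell (r (c (φ w)) z / Fintype.card W) := fun w =>
      hGz.comp (measurable_pi_apply (φ w))
    have m3 : ∀ w : W, Measurable fun c : J → X =>
        ∑ w' ∈ Finset.univ.erase w, (r (c (φ w)) z : ℝ≥0∞) * r (c (φ w')) z := fun w =>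
      Finset.measurable_sum _ fun w' _ => (m1 w).mul (m1 w')
    have m4 : ∀ w : W, Measurable fun c : J → X =>
        ((r (c (φ w)) z : ℝ≥0∞) * ell (r (c (φ w)) z / Fintype.card W) +
        (Fintype.card W : ℝ≥0∞)⁻¹ *
          ∑ w' ∈ Finset.univ.erase w, (r (c (φ w)) z : ℝ≥0∞) * r (c (φ w')) z) := fun w =>
      (m2 w).add ((m3 w).const_mul _)
    rw [lintegral_const_mul _ (Finset.measurable_sum _ fun w _ => m4 w),
      lintegral_finsetSum _ (fun w _ => m4 w)]
    refine le_trans ?_ (le_of_eq (card_inv_mul_sum_const (W := W) _))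
    gcongr with w _
    rw [lintegral_add_left (m2 w), lintegral_const_mul _ (m3 w),
      lintegral_finsetSum _ (f := fun w' (c : J → X) => (r (c (φ w)) z : ℝ≥0∞) * r (c (φ w')) z)
        (fun w' _ => (m1 w).mul (m1 w')),
      lintegral_pi_single p (φ w) _ hGz]
    refine add_le_add le_rfl ?_
    refine le_trans ?_ (le_of_eq (card_inv_mul_sum_const (W := W) _))
    refine mul_le_mul_right ?_ _
    refine le_trans (Finset.sum_le_sum fun w' hw' => ?_)
      (Finset.sum_le_sum_of_subset (Finset.erase_subset w Finset.univ))
    rw [lintegral_pi_pair p (φ w) (φ w') (fun e => (Finset.ne_of_mem_erase hw') (hφ e).symm)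
      (fun x => (r x z : ℝ≥0∞)) (fun x => (r x z : ℝ≥0∞)) hrze hrze]
  refine (lintegral_mono key).trans ?_
  have hG' : Measurable fun z => ∫⁻ x, r x z * ell (r x z / Fintype.card W) ∂p :=
    Measurable.lintegral_prod_left' (f := fun q : X × Z => (r q.1 q.2 : ℝ≥0∞) * ell (r q.1 q.2 / Fintype.card W)) hG
  have hsw2 := lintegral_lintegral_swap (μ := p) (ν := Q)
    (f := fun x z => (r x z : ℝ≥0∞) * ell (r x z / Fintype.card W)) hG.aemeasurable
  have hsw3 := lintegral_lintegral_swap (μ := p) (ν := Q)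
    (f := fun x z => (r x z : ℝ≥0∞)) hre.aemeasurable
  rw [lintegral_add_left hG', ← hsw2]
  gcongr
  have hh : Measurable fun z => ∫⁻ x, (r x z : ℝ≥0∞) ∂p :=
    Measurable.lintegral_prod_left' (f := fun q : X × Z => (r q.1 q.2 : ℝ≥0∞)) hre
  calc ∫⁻ z, (∫⁻ x, r x z ∂p) * ∫⁻ x, r x z ∂p ∂Q ≤ ∫⁻ z, 2 * ∫⁻ x, r x z ∂p ∂Q := by
        apply lintegral_mono_ae
        filter_upwards [h.mix] with z hz
        gcongr
    _ = 2 := by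
        rw [lintegral_const_mul _ hh, ← hsw3]
        simp [h.int1]



/-! ### Threshold decoding -/

def loI (τ t : ℝ≥0) : ℝ≥0∞ := if t ≤ τ then 1 else 0
def hiI (τ t : ℝ≥0) : ℝ≥0∞ := if τ < t then 1 else 0

theorem measurable_loI (τ : ℝ≥0) : Measurable (loI τ) :=
  Measurable.ite measurableSet_Iic measurable_const measurable_const
theorem measurable_hiI (τ : ℝ≥0) : Measurable (hiI τ) :=
  Measurable.ite measurableSet_Ioi measurable_const measurable_const

theorem hiI_le (τ t : ℝ≥0) (hτ : 0 < τ) : hiI τ t ≤ (τ : ℝ≥0∞)⁻¹ * t := by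
  unfold hiI
  split_ifs with h
  · rw [← ENNReal.coe_inv hτ.ne', ← ENNReal.coe_mul, ← ENNReal.coe_one, ENNReal.coe_le_coe,
      inv_mul_eq_div, one_le_div hτ]
    exact h.le
  · exact zero_le

/-- Upper bound on the error probability of the threshold decoder for codeword `j`. -/
def errU {X Z J : Type*} [Fintype J] [DecidableEq J] [MeasurableSpace Z] (Q : Measure Z)
    (r : X → Z → ℝ≥0) (τ : ℝ≥0) (c : J → X) (j : J) : ℝ≥0∞ :=
  ∫⁻ z, ((r (c j) z : ℝ≥0∞) * loI τ (r (c j) z) +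
    ∑ k ∈ Finset.univ.erase j, (r (c j) z : ℝ≥0∞) * hiI τ (r (c k) z)) ∂Q

theorem measurable_errU {X Z J : Type*} [Fintype J] [DecidableEq J] [MeasurableSpace X]
    [MeasurableSpace Z] (Q : Measure Z) [SFinite Q]
    (r : X → Z → ℝ≥0) (hr : Measurable (fun q : X × Z => r q.1 q.2)) (τ : ℝ≥0) (j : J) :
    Measurable (fun q : (J → X) × Z => ((r (q.1 j) q.2 : ℝ≥0∞) * loI τ (r (q.1 j) q.2) +
    ∑ k ∈ Finset.univ.erase j, (r (q.1 j) q.2 : ℝ≥0∞) * hiI τ (r (q.1 k) q.2))) := by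
  have h1 : ∀ j : J, Measurable (fun q : (J → X) × Z => r (q.1 j) q.2) := by
    intro j
    have h1 : Measurable (fun q : (J → X) × Z => (q.1 j, q.2)) := by fun_prop
    exact hr.comp h1
  have h2 := fun j => (measurable_loI τ).comp (h1 j)
  have h3 := fun j => (measurable_hiI τ).comp (h1 j)
  exact ((h1 j).coe_nnreal_ennreal.mul (h2 j)).add
    (Finset.measurable_sum _ fun k _ => (h1 j).coe_nnreal_ennreal.mul (h3 k))

theorem decode_exp {X Z J : Type*} [MeasurableSpace X] [MeasurableSpace Z] [Fintype J]
    [DecidableEq J] (p : Measure X) [IsProbabilityMeasure p] (Q : Measure Z)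
    [IsProbabilityMeasure Q] (r : X → Z → ℝ≥0) (h : Chan p Q r) (τ : ℝ≥0) (hτ : 0 < τ) (j : J) :
    ∫⁻ c, errU Q r τ c j ∂(Measure.pi fun _ : J => p) ≤
      (∫⁻ x, ∫⁻ z, r x z * loI τ (r x z) ∂Q ∂p) + Fintype.card J * (2 * (τ : ℝ≥0∞)⁻¹) := by
  have hre : Measurable (fun q : X × Z => (r q.1 q.2 : ℝ≥0∞)) := h.meas.coe_nnreal_ennreal
  have hG : Measurable (fun q : X × Z => (r q.1 q.2 : ℝ≥0∞) * loI τ (r q.1 q.2)) :=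
    hre.mul ((measurable_loI τ).comp h.meas)
  have hH : Measurable (fun q : X × Z => hiI τ (r q.1 q.2)) := (measurable_hiI τ).comp h.meas
  have hsec : ∀ z : Z, Measurable fun x : X => (x, z) := fun z => measurable_id.prodMk measurable_const
  have hsw := lintegral_lintegral_swap (μ := Measure.pi fun _ : J => p) (ν := Q)
    (f := fun c z => ((r (c j) z : ℝ≥0∞) * loI τ (r (c j) z) +
    ∑ k ∈ Finset.univ.erase j, (r (c j) z : ℝ≥0∞) * hiI τ (r (c k) z)))
    (measurable_errU Q r h.meas τ j).aemeasurable
  unfold errU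
  rw [hsw]
  have key : ∀ z, ∫⁻ c, ((r (c j) z : ℝ≥0∞) * loI τ (r (c j) z) +
      ∑ k ∈ Finset.univ.erase j, (r (c j) z : ℝ≥0∞) * hiI τ (r (c k) z))
      ∂(Measure.pi fun _ : J => p) ≤ (∫⁻ x, r x z * loI τ (r x z) ∂p) +
        Fintype.card J * ((∫⁻ x, r x z ∂p) * ∫⁻ x, hiI τ (r x z) ∂p) := by
    intro z
    have n1 : Measurable fun x => (r x z : ℝ≥0∞) := hre.comp (hsec z)
    have n2 : Measurable fun x => (r x z : ℝ≥0∞) * loI τ (r x z) := hG.comp (hsec z)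
    have n3 : Measurable fun x => hiI τ (r x z) := hH.comp (hsec z)
    have m2 : Measurable fun c : J → X => (r (c j) z : ℝ≥0∞) * loI τ (r (c j) z) :=
      n2.comp (measurable_pi_apply j)
    have m1 : Measurable fun c : J → X => (r (c j) z : ℝ≥0∞) := n1.comp (measurable_pi_apply j)
    have m3 : ∀ k : J, Measurable fun c : J → X => hiI τ (r (c k) z) := fun k =>
      n3.comp (measurable_pi_apply k)
    rw [lintegral_add_left m2, lintegral_pi_single p j _ n2,
      lintegral_finsetSum _ (f := fun k (c : J → X) => (r (c j) z : ℝ≥0∞) * hiI τ (r (c k) z))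
        (fun k _ => m1.mul (m3 k))]
    refine add_le_add le_rfl ?_
    rw [← nsmul_eq_mul, ← Finset.card_univ, ← Finset.sum_const]
    refine le_trans (Finset.sum_le_sum fun k hk => ?_)
      (Finset.sum_le_sum_of_subset (Finset.erase_subset j Finset.univ))
    rw [lintegral_pi_pair p j k (Finset.ne_of_mem_erase hk).symm
      (fun x => (r x z : ℝ≥0∞)) (fun x => hiI τ (r x z)) n1 n3]
  refine (lintegral_mono key).trans ?_
  have hG' : Measurable fun z => ∫⁻ x, r x z * loI τ (r x z) ∂p :=
    Measurable.lintegral_prod_left' (f := fun q : X × Z => (r q.1 q.2 : ℝ≥0∞) * loI τ (r q.1 q.2)) hG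
  have hh : Measurable fun z => ∫⁻ x, (r x z : ℝ≥0∞) ∂p :=
    Measurable.lintegral_prod_left' (f := fun q : X × Z => (r q.1 q.2 : ℝ≥0∞)) hre
  have hH' : Measurable fun z => ∫⁻ x, hiI τ (r x z) ∂p :=
    Measurable.lintegral_prod_left' (f := fun q : X × Z => hiI τ (r q.1 q.2)) hH
  have hsw2 := lintegral_lintegral_swap (μ := p) (ν := Q)
    (f := fun x z => (r x z : ℝ≥0∞) * loI τ (r x z)) hG.aemeasurable
  have hsw3 := lintegral_lintegral_swap (μ := p) (ν := Q)
    (f := fun x z => hiI τ (r x z)) hH.aemeasurable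
  rw [lintegral_add_left hG', ← hsw2, lintegral_const_mul _
    (f := fun z => (∫⁻ x, (r x z : ℝ≥0∞) ∂p) * ∫⁻ x, hiI τ (r x z) ∂p) (hh.mul hH')]
  refine add_le_add le_rfl (mul_le_mul_right ?_ _)
  calc ∫⁻ z, (∫⁻ x, r x z ∂p) * ∫⁻ x, hiI τ (r x z) ∂p ∂Q ≤
        ∫⁻ z, 2 * ∫⁻ x, hiI τ (r x z) ∂p ∂Q := by
        apply lintegral_mono_ae
        filter_upwards [h.mix] with z hz
        gcongr
    _ = 2 * ∫⁻ x, ∫⁻ z, hiI τ (r x z) ∂Q ∂p := by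
        rw [lintegral_const_mul _ hH', ← hsw3]
    _ ≤ 2 * ∫⁻ x, ∫⁻ z, (τ : ℝ≥0∞)⁻¹ * r x z ∂Q ∂p := by
        gcongr with x z
        exact hiI_le _ _ hτ
    _ = 2 * (τ : ℝ≥0∞)⁻¹ := by
        congr 1
        have : ∀ x, ∫⁻ z, (τ : ℝ≥0∞)⁻¹ * r x z ∂Q = (τ : ℝ≥0∞)⁻¹ := by
          intro x
          rw [lintegral_const_mul, h.int1, mul_one]
          exact hre.comp (measurable_const.prodMk measurable_id)
        simp [this]

theorem exists_dec {X Z J : Type*} [MeasurableSpace X] [MeasurableSpace Z] [Fintype J] [Nonempty J]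
    [DecidableEq J] [MeasurableSpace J] (Q : Measure Z) (r : X → Z → ℝ≥0)
    (hr : Measurable (fun q : X × Z => r q.1 q.2)) (τ : ℝ≥0) (c : J → X) :
    ∃ dec : Z → J, Measurable dec ∧ ∀ j,
      (Q.withDensity (fun z => (r (c j) z : ℝ≥0∞))) {z | dec z ≠ j} ≤ errU Q r τ c j := by
  classical
  have hrm : ∀ j, Measurable (r (c j)) := fun j => hr.comp (measurable_const.prodMk measurable_id)
  let g : Z → (J → Prop) := fun z j => τ < r (c j) z
  have hg : Measurable g := by
    refine measurable_pi_lambda _ fun j => ?_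
    exact measurableSet_setOfPred.mp (measurableSet_lt measurable_const (hrm j))
  let D : (J → Prop) → J := fun b => if h : ∃ j, b j then h.choose else Classical.arbitrary J
  have hD : Measurable D := measurable_of_finite D
  refine ⟨D ∘ g, hD.comp hg, fun j => ?_⟩
  have hprop : ∀ z, τ < r (c j) z → (∀ k ∈ Finset.univ.erase j, ¬ τ < r (c k) z) → D (g z) = j := by
    intro z h1 h2
    have hex : ∃ j, g z j := ⟨j, h1⟩
    simp only [D, dif_pos hex]
    by_contra hne
    exact h2 _ (Finset.mem_erase.mpr ⟨hne, Finset.mem_univ _⟩) hex.choose_spec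
  have hms : MeasurableSet {z | (D ∘ g) z ≠ j} := by
    have : {z | (D ∘ g) z ≠ j} = g ⁻¹' {b | D b ≠ j} := rfl
    rw [this]
    exact hg (Set.toFinite _).measurableSet
  rw [withDensity_apply _ hms, ← lintegral_indicator hms]
  unfold errU
  refine lintegral_mono fun z => ?_
  by_cases hz : z ∈ {z | (D ∘ g) z ≠ j}
  · rw [Set.indicator_of_mem hz]
    by_cases h1 : τ < r (c j) z
    · have : ∃ k ∈ Finset.univ.erase j, τ < r (c k) z := by
        by_contra hcon
        push Not at hcon
        exact hz (hprop z h1 fun k hk => not_lt.mpr (hcon k hk))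
      obtain ⟨k, hk, hk2⟩ := this
      refine le_trans ?_ le_add_self
      refine le_trans ?_ (Finset.single_le_sum (fun _ _ => zero_le) hk)
      simp [hiI, hk2]
    · refine le_trans ?_ le_self_add
      simp [loI, not_lt.mp h1]
  · rw [Set.indicator_of_notMem hz]
    exact zero_le



/-! ### Existence of a good codebook -/

theorem lintegral_avg_le {Ω J : Type*} [MeasurableSpace Ω] [Fintype J] [Nonempty J] (μ : Measure Ω)
    (f : J → Ω → ℝ≥0∞) (hf : ∀ j, Measurable (f j)) (t : ℝ≥0∞) (h : ∀ j, ∫⁻ x, f j x ∂μ ≤ t) :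
    ∫⁻ x, (Fintype.card J : ℝ≥0∞)⁻¹ * ∑ j, f j x ∂μ ≤ t := by
  rw [lintegral_const_mul _ (Finset.measurable_sum _ fun j _ => hf j),
    lintegral_finsetSum _ (fun j _ => hf j)]
  refine le_trans ?_ (le_of_eq (card_inv_mul_sum_const (W := J) t))
  exact mul_le_mul_right (Finset.sum_le_sum fun j _ => h j) _

theorem withDensity_mixR {X Z W : Type*} [Fintype W] [Nonempty W] [MeasurableSpace X]
    [MeasurableSpace Z]
    (Q : Measure Z) (r : X → Z → ℝ≥0)
    (hr : Measurable (fun q : X × Z => r q.1 q.2)) (d : W → X) :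
    (avgM fun w => Q.withDensity (fun z => (r (d w) z : ℝ≥0∞))) =
      Q.withDensity (fun z => (mixR r d z : ℝ≥0∞)) := by
  have hrm : ∀ w, Measurable fun z => (r (d w) z : ℝ≥0∞) := fun w =>
    (hr.comp (measurable_const.prodMk measurable_id)).coe_nnreal_ennreal
  ext s hs
  rw [avgM_apply, withDensity_apply _ hs]
  have : ∀ z, (mixR r d z : ℝ≥0∞) = (Fintype.card W : ℝ≥0∞)⁻¹ * ∑ w, (r (d w) z : ℝ≥0∞) := by
    intro z
    unfold mixR
    rw [ENNReal.coe_mul, ENNReal.ofNNReal_finsetSum, ENNReal.coe_inv (by simp)]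
    simp
  simp only [this]
  rw [lintegral_const_mul _ (Finset.measurable_sum _ fun j _ => hrm j),
    lintegral_finsetSum _ (fun j _ => hrm j)]
  simp only [withDensity_apply _ hs]

theorem leak_of_mixR {X Z W M : Type*} [Fintype W] [Nonempty W] [Fintype M] [MeasurableSpace X]
    [MeasurableSpace Z]
    (Q : Measure Z) [IsProbabilityMeasure Q] (r : X → Z → ℝ≥0)
    (hr : Measurable (fun q : X × Z => r q.1 q.2)) (d : M → W → X) (t : ℝ≥0∞)
    (h : (Fintype.card M : ℝ≥0∞)⁻¹ * ∑ m, ∫⁻ z, (mixR r (d m) z : ℝ≥0∞) * ell (mixR r (d m) z) ∂Q ≤ t) :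
    Leak (fun m => avgM fun w => Q.withDensity (fun z => (r (d m w) z : ℝ≥0∞))) t := by
  have hm : ∀ m, Measurable (mixR r (d m)) := fun m =>
    (measurable_mixR_joint hr (fun w : W => w)).comp (measurable_const.prodMk measurable_id)
  refine ⟨Q, inferInstance, fun m => mixR r (d m), hm,
    fun m => withDensity_mixR Q r hr (d m), ?_⟩
  refine le_trans (le_of_eq ?_) h
  congr 1
  refine Finset.sum_congr rfl fun m _ => ?_
  beta_reduce
  rw [withDensity_mixR Q r hr (d m),
    lintegral_withDensity_eq_lintegral_mul _ (hm m).coe_nnreal_ennreal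
      (measurable_ell_comp (hm m))]
  rfl

theorem exists_code {X Z A B C : Type*} [MeasurableSpace X] [MeasurableSpace Z]
    [Fintype A] [Fintype B] [Fintype C] [Nonempty A] [Nonempty B] [Nonempty C]
    [MeasurableSpace (A × B × C)]
    (p : Measure X) [IsProbabilityMeasure p] (S : Set X) (hS : p Sᶜ = 0)
    (Qa Q2 Q1 : Measure Z) [IsProbabilityMeasure Qa] [IsProbabilityMeasure Q2]
    [IsProbabilityMeasure Q1] (ra r2 r1 : X → Z → ℝ≥0)
    (ha : Chan p Qa ra) (h2 : Chan p Q2 r2) (h1 : Chan p Q1 r1) (τ : ℝ≥0) (hτ : 0 < τ)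
    (κ : ℝ≥0∞) (hκ : κ ≠ 0) (hκ' : κ ≠ ⊤) (E : ℝ≥0∞)
    (hE : ((∫⁻ x, ∫⁻ z, ra x z * loI τ (ra x z) ∂Qa ∂p) +
        Fintype.card (A × B × C) * (2 * (τ : ℝ≥0∞)⁻¹)) +
      κ * ((∫⁻ x, ∫⁻ z, r2 x z * ell (r2 x z / Fintype.card C) ∂Q2 ∂p) + 2) +
      κ * ((∫⁻ x, ∫⁻ z, r1 x z * ell (r1 x z / Fintype.card (B × C)) ∂Q1 ∂p) + 2) ≤ E) :
    ∃ c : A × B × C → X, (∀ j, c j ∈ S) ∧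
      (∃ dec : Z → A × B × C, Measurable dec ∧
        (Fintype.card (A × B × C) : ℝ≥0∞)⁻¹ *
          ∑ j, (Qa.withDensity (fun z => (ra (c j) z : ℝ≥0∞))) {z | dec z ≠ j} ≤ E) ∧
      Leak (fun m : A × B => avgM fun w : C =>
        Q2.withDensity (fun z => (r2 (c (m.1, m.2, w)) z : ℝ≥0∞))) (κ⁻¹ * E) ∧
      Leak (fun m : A => avgM fun w : B × C =>
        Q1.withDensity (fun z => (r1 (c (m, w)) z : ℝ≥0∞))) (κ⁻¹ * E) := by
  classical
  let f0 : (A × B × C → X) → ℝ≥0∞ := fun c =>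
    (Fintype.card (A × B × C) : ℝ≥0∞)⁻¹ * ∑ j, errU Qa ra τ c j
  let f2 : (A × B × C → X) → ℝ≥0∞ := fun c =>
    (Fintype.card (A × B) : ℝ≥0∞)⁻¹ * ∑ m : A × B,
      ∫⁻ z, (mixR r2 (fun w : C => c (m.1, m.2, w)) z : ℝ≥0∞) *
        ell (mixR r2 (fun w : C => c (m.1, m.2, w)) z) ∂Q2
  let f1 : (A × B × C → X) → ℝ≥0∞ := fun c =>
    (Fintype.card A : ℝ≥0∞)⁻¹ * ∑ m : A,
      ∫⁻ z, (mixR r1 (fun w : B × C => c (m, w)) z : ℝ≥0∞) *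
        ell (mixR r1 (fun w : B × C => c (m, w)) z) ∂Q1
  have m0 : ∀ j, Measurable fun c : A × B × C → X => errU Qa ra τ c j := fun j =>
    Measurable.lintegral_prod_right' (measurable_errU Qa ra ha.meas τ j)
  have m2 : ∀ m : A × B, Measurable fun c : A × B × C → X =>
      ∫⁻ z, (mixR r2 (fun w : C => c (m.1, m.2, w)) z : ℝ≥0∞) *
        ell (mixR r2 (fun w : C => c (m.1, m.2, w)) z) ∂Q2 := fun m => by
    have hm := measurable_mixR_joint h2.meas (fun w : C => (m.1, m.2, w))
    exact Measurable.lintegral_prod_right' (hm.coe_nnreal_ennreal.mul (measurable_ell_comp hm))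
  have m1 : ∀ m : A, Measurable fun c : A × B × C → X =>
      ∫⁻ z, (mixR r1 (fun w : B × C => c (m, w)) z : ℝ≥0∞) *
        ell (mixR r1 (fun w : B × C => c (m, w)) z) ∂Q1 := fun m => by
    have hm := measurable_mixR_joint h1.meas (fun w : B × C => (m, w))
    exact Measurable.lintegral_prod_right' (hm.coe_nnreal_ennreal.mul (measurable_ell_comp hm))
  have n0 : Measurable f0 := (Finset.measurable_sum _ fun j _ => m0 j).const_mul _
  have n2 : Measurable f2 := (Finset.measurable_sum _ fun j _ => m2 j).const_mul _
  have n1 : Measurable f1 := (Finset.measurable_sum _ fun j _ => m1 j).const_mul _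
  have i0 := lintegral_avg_le (Measure.pi fun _ : A × B × C => p)
    (fun j c => errU Qa ra τ c j) m0 _ (fun j => decode_exp p Qa ra ha τ hτ j)
  have i2 := lintegral_avg_le (Measure.pi fun _ : A × B × C => p) _ m2 _
    (fun m : A × B => resolv p Q2 r2 h2 (fun w : C => (m.1, m.2, w))
      (fun x y hxy => by simpa using hxy))
  have i1 := lintegral_avg_le (Measure.pi fun _ : A × B × C => p) _ m1 _
    (fun m : A => resolv p Q1 r1 h1 (fun w : B × C => (m, w))
      (fun x y hxy => by simpa using hxy))
  have hN : (Measure.pi fun _ : A × B × C => p) {c | ∃ j, c j ∉ S} = 0 := by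
    have : {c : A × B × C → X | ∃ j, c j ∉ S} = ⋃ j, Function.eval j ⁻¹' Sᶜ := by
      ext c; simp
    rw [this, measure_iUnion_null_iff]
    intro j
    exact (measurePreserving_eval (fun _ : A × B × C => p) j).quasiMeasurePreserving.preimage_null hS
  obtain ⟨c, hc, hcE⟩ := exists_notMem_null_le_lintegral
    (μ := Measure.pi fun _ : A × B × C => p) (f := fun c => f0 c + κ * f2 c + κ * f1 c)
    (((n0.add (n2.const_mul κ)).add (n1.const_mul κ)).aemeasurable) hN
  have htot : f0 c + κ * f2 c + κ * f1 c ≤ E := by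
    refine hcE.trans (le_trans ?_ hE)
    rw [lintegral_add_right _ (n1.const_mul κ), lintegral_add_right _ (n2.const_mul κ),
      lintegral_const_mul _ n1, lintegral_const_mul _ n2]
    exact add_le_add (add_le_add i0 (mul_le_mul_right i2 _)) (mul_le_mul_right i1 _)
  have hdiv : ∀ t, κ * t ≤ E → t ≤ κ⁻¹ * E := by
    intro t ht
    calc t = κ⁻¹ * (κ * t) := by
          rw [← mul_assoc, ENNReal.inv_mul_cancel hκ hκ', one_mul]
      _ ≤ _ := mul_le_mul_right ht _
  refine ⟨c, fun j => ?_, ?_, ?_, ?_⟩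
  · by_contra hcon
    exact hc ⟨j, hcon⟩
  · obtain ⟨dec, hd, hd2⟩ := exists_dec Qa ra ha.meas τ c
    refine ⟨dec, hd, le_trans ?_ (le_trans (le_self_add.trans le_self_add) htot)⟩
    exact mul_le_mul_right (Finset.sum_le_sum fun j _ => hd2 j) _
  · refine leak_of_mixR Q2 r2 h2.meas (fun (m : A × B) (w : C) => c (m.1, m.2, w)) _ (hdiv _ ?_)
    exact le_trans (le_add_self.trans le_self_add) htot
  · refine leak_of_mixR Q1 r1 h1.meas (fun (m : A) (w : B × C) => c (m, w)) _ (hdiv _ ?_)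
    exact le_trans le_add_self htot



/-! ### Single-letter Gaussian facts -/

/-- Output density ratio of the scalar Gaussian channel. -/
def gR (g v : ℝ≥0) (x z : ℝ) : ℝ≥0 :=
  (gaussianPDFReal (√(g : ℝ) * x) 1 z / gaussianPDFReal 0 (g * v + 1) z).toNNReal

theorem gR_pos (g v : ℝ≥0) (x z : ℝ) : 0 < gR g v x z := by
  unfold gR
  rw [Real.toNNReal_pos]
  exact div_pos (gaussianPDFReal_pos _ _ _ one_ne_zero) (gaussianPDFReal_pos _ _ _ (by positivity))

theorem measurable_gR (g v : ℝ≥0) : Measurable (fun q : ℝ × ℝ => gR g v q.1 q.2) := by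
  unfold gR
  refine Measurable.real_toNNReal (Measurable.div ?_ ?_)
  · have h : Measurable (fun q : ℝ × ℝ => (√(g : ℝ) * q.1, ((1 : ℝ≥0), q.2))) := by fun_prop
    exact measurable_uncurry_gaussianPDFReal.comp h
  · exact (measurable_gaussianPDFReal _ _).comp measurable_snd

theorem gR_withDensity (g v : ℝ≥0) (x : ℝ) :
    gaussianReal (√(g : ℝ) * x) 1 =
      (gaussianReal 0 (g * v + 1)).withDensity (fun z => (gR g v x z : ℝ≥0∞)) := by
  have hm : Measurable fun z => (gR g v x z : ℝ≥0∞) :=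
    ((measurable_gR g v).comp (measurable_const.prodMk measurable_id)).coe_nnreal_ennreal
  rw [gaussianReal_of_var_ne_zero _ (one_ne_zero), gaussianReal_of_var_ne_zero 0
    (v := g * v + 1) (by positivity), ← withDensity_mul _ (measurable_gaussianPDF _ _) hm]
  congr 1
  funext z
  have h0 : 0 < gaussianPDFReal 0 (g * v + 1) z := gaussianPDFReal_pos _ _ _ (by positivity)
  have : (gR g v x z : ℝ≥0∞) =
    ENNReal.ofReal (gaussianPDFReal (√(g : ℝ) * x) 1 z / gaussianPDFReal 0 (g * v + 1) z) := rfl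
  simp only [Pi.mul_apply, this, gaussianPDF]
  rw [← ENNReal.ofReal_mul h0.le, mul_div_cancel₀ _ h0.ne']

theorem log_gR (g v : ℝ≥0) (x z : ℝ) :
    Real.log (gR g v x z) = 1 / 2 * Real.log (1 + g * v) + z ^ 2 / (2 * (1 + g * v)) -
      (z - √(g : ℝ) * x) ^ 2 / 2 := by
  have h1 := gaussianPDFReal_pos (√(g : ℝ) * x) 1 z one_ne_zero
  have h0 := gaussianPDFReal_pos 0 (g * v + 1) z (by positivity)
  have hq : (0 : ℝ) < 1 + g * v := by positivity
  have hcoe : (gR g v x z : ℝ) =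
    gaussianPDFReal (√(g : ℝ) * x) 1 z / gaussianPDFReal 0 (g * v + 1) z :=
    Real.coe_toNNReal _ (div_pos h1 h0).le
  rw [hcoe, Real.log_div h1.ne' h0.ne']
  simp only [gaussianPDFReal]
  rw [Real.log_mul (by positivity) (Real.exp_pos _).ne', Real.log_mul (by positivity) (Real.exp_pos _).ne',
    Real.log_exp, Real.log_exp, Real.log_inv, Real.log_inv, Real.log_sqrt (by positivity),
    Real.log_sqrt (by positivity)]
  push_cast
  rw [add_comm (g * v : ℝ) 1, Real.log_mul (by positivity) hq.ne', mul_one]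
  field_simp
  ring

/-- joint law of input and output -/
def gJ (g v : ℝ≥0) : Measure (ℝ × ℝ) :=
  ((gaussianReal 0 v).prod (gaussianReal 0 1)).map (fun p => (p.1, √(g : ℝ) * p.1 + p.2))

theorem gJ_meas (g : ℝ≥0) : Measurable (fun p : ℝ × ℝ => (p.1, √(g : ℝ) * p.1 + p.2)) := by fun_prop

theorem gJ_eq (g v : ℝ≥0) : ((gaussianReal 0 v).prod (gaussianReal 0 (g * v + 1))).withDensity
    (fun q => (gR g v q.1 q.2 : ℝ≥0∞)) = gJ g v := by
  have hm : Measurable fun q : ℝ × ℝ => (gR g v q.1 q.2 : ℝ≥0∞) :=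
    (measurable_gR g v).coe_nnreal_ennreal
  ext s hs
  rw [withDensity_apply _ hs, gJ, Measure.map_apply (gJ_meas g) hs,
    Measure.prod_apply (gJ_meas g hs), ← lintegral_indicator hs,
    lintegral_prod _ ((hm.indicator hs).aemeasurable)]
  refine lintegral_congr fun x => ?_
  have hsx : MeasurableSet (Prod.mk x ⁻¹' s) := measurable_prodMk_left hs
  have e1 : gaussianReal (√(g : ℝ) * x) 1 (Prod.mk x ⁻¹' s) =
      ∫⁻ y, s.indicator (fun q : ℝ × ℝ => (gR g v q.1 q.2 : ℝ≥0∞)) (x, y) ∂gaussianReal 0 (g * v + 1) := by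
    rw [gR_withDensity g v x, withDensity_apply _ hsx, ← lintegral_indicator hsx]
    rfl
  rw [← e1]
  have e2 := gaussianReal_map_const_add (μ := 0) (v := 1) (√(g : ℝ) * x)
  rw [zero_add] at e2
  rw [← e2, Measure.map_apply (by fun_prop) hsx]
  rfl

instance (g v : ℝ≥0) : IsProbabilityMeasure (gJ g v) :=
  Measure.isProbabilityMeasure_map (gJ_meas g).aemeasurable

theorem gJ_snd (g v : ℝ≥0) : (gJ g v).map Prod.snd = gaussianReal 0 (g * v + 1) := by
  rw [gJ, Measure.map_map measurable_snd (gJ_meas g)]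
  have h := gaussianReal_conv_gaussianReal (m₁ := 0) (m₂ := 0) (v₁ := g * v) (v₂ := 1)
  have e := gaussianReal_map_const_mul (μ := 0) (v := v) (√(g : ℝ))
  have e3 : NNReal.mk (√(g : ℝ) ^ 2) (sq_nonneg _) = g := by
    ext; simp
  rw [e3, mul_zero] at e
  rw [add_zero] at h
  rw [← h, ← e, Measure.conv]
  have : gaussianReal 0 1 = (gaussianReal 0 1).map id := by simp
  conv_rhs => rw [this]
  rw [Measure.map_prod_map _ _ (by fun_prop) measurable_id, Measure.map_map (by fun_prop) (by fun_prop)]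
  rfl

theorem gR_mix (g v : ℝ≥0) : ∀ᵐ z ∂(gaussianReal 0 (g * v + 1)),
    ∫⁻ x, gR g v x z ∂(gaussianReal 0 v) = 1 := by
  have hm : Measurable fun q : ℝ × ℝ => (gR g v q.1 q.2 : ℝ≥0∞) :=
    (measurable_gR g v).coe_nnreal_ennreal
  refine ae_eq_of_forall_setLIntegral_eq_of_sigmaFinite (g := fun _ => 1)
    (Measurable.lintegral_prod_left' hm) measurable_const fun s hs _ => ?_
  rw [setLIntegral_one]
  conv_rhs => rw [← gJ_snd g v, Measure.map_apply measurable_snd hs, ← gJ_eq,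
    withDensity_apply _ (measurable_snd hs)]
  have : Prod.snd ⁻¹' s = (Set.univ : Set ℝ) ×ˢ s := by ext; simp
  rw [this, ← Measure.prod_restrict, Measure.restrict_univ, lintegral_prod_symm _ hm.aemeasurable]

theorem memLp_sq_gaussian (v : ℝ≥0) : MemLp (fun x : ℝ => x ^ 2) 2 (gaussianReal 0 v) := by
  have h := memLp_id_gaussianReal' (μ := 0) (v := v) 4 (by simp)
  have h2 := h.integrable_norm_pow (p := 4) (by norm_num)
  rw [memLp_two_iff_integrable_sq (by fun_prop)]
  refine h2.congr (Filter.Eventually.of_forall fun x => ?_)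
  simp only [id, Real.norm_eq_abs]
  rw [show (4 : ℕ) = 2 * 2 by norm_num, pow_mul, sq_abs]

theorem integral_sq_gaussian (v : ℝ≥0) : ∫ x, x ^ 2 ∂(gaussianReal 0 v) = v := by
  have h := variance_fun_id_gaussianReal (μ := 0) (v := v)
  rw [variance_eq_integral (by fun_prop)] at h
  simpa using h

theorem gJ_memLp_integral (g v : ℝ≥0) :
    MemLp (fun q : ℝ × ℝ => Real.log (gR g v q.1 q.2)) 2 (gJ g v) ∧
    ∫ q, Real.log (gR g v q.1 q.2) ∂(gJ g v) = 1 / 2 * Real.log (1 + g * v) := by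
  have hz : MeasurePreserving Prod.snd (gJ g v) (gaussianReal 0 (g * v + 1)) :=
    ⟨measurable_snd, gJ_snd g v⟩
  have hn : MeasurePreserving (fun q : ℝ × ℝ => q.2 - √(g : ℝ) * q.1) (gJ g v) (gaussianReal 0 1) := by
    refine ⟨by fun_prop, ?_⟩
    rw [gJ, Measure.map_map (by fun_prop) (gJ_meas g)]
    have : (fun q : ℝ × ℝ => q.2 - √(g : ℝ) * q.1) ∘ (fun p : ℝ × ℝ => (p.1, √(g : ℝ) * p.1 + p.2)) =
        Prod.snd := by
      funext p; simp
    rw [this]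
    exact measurePreserving_snd.map_eq
  have m1 := (memLp_sq_gaussian (g * v + 1)).comp_measurePreserving hz
  have m2 := (memLp_sq_gaussian 1).comp_measurePreserving hn
  have i1 : ∫ q : ℝ × ℝ, q.2 ^ 2 ∂(gJ g v) = 1 + g * v := by
    have := integral_map (μ := gJ g v) (φ := Prod.snd) measurable_snd.aemeasurable
      (f := fun x : ℝ => x ^ 2) (by fun_prop)
    rw [← this, gJ_snd, integral_sq_gaussian]
    push_cast; ring
  have i2 : ∫ q : ℝ × ℝ, (q.2 - √(g : ℝ) * q.1) ^ 2 ∂(gJ g v) = 1 := by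
    have := integral_map (μ := gJ g v) (φ := fun q : ℝ × ℝ => q.2 - √(g : ℝ) * q.1)
      (by fun_prop) (f := fun x : ℝ => x ^ 2) (by fun_prop)
    rw [← this, hn.map_eq, integral_sq_gaussian]
    simp
  simp only [log_gR]
  have M1 : MemLp (fun q : ℝ × ℝ => q.2 ^ 2 / (2 * (1 + g * v : ℝ))) 2 (gJ g v) := by
    simp only [div_eq_inv_mul]; exact m1.const_mul _
  have M2 : MemLp (fun q : ℝ × ℝ => (q.2 - √(g : ℝ) * q.1) ^ 2 / 2) 2 (gJ g v) := by
    simp only [div_eq_inv_mul]; exact m2.const_mul _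
  have M0 : MemLp (fun _ : ℝ × ℝ => 1 / 2 * Real.log (1 + g * v)) 2 (gJ g v) := memLp_const _
  refine ⟨(M0.add M1).sub M2, ?_⟩
  have hitg : ∀ {f : ℝ × ℝ → ℝ}, MemLp f 2 (gJ g v) → Integrable f (gJ g v) :=
    fun h => h.integrable (by norm_num)
  rw [integral_sub (f := fun q : ℝ × ℝ => 1 / 2 * Real.log (1 + g * v) +
    q.2 ^ 2 / (2 * (1 + g * v : ℝ))) (hitg (M0.add M1)) (hitg M2), integral_add (hitg M0) (hitg M1),
    integral_div, integral_div, i1, i2]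
  have hq : (1 + g * v : ℝ) ≠ 0 := by positivity
  simp
  field_simp
  simp

attribute [irreducible] gR



/-! ### Block Gaussian facts -/


def gLaw {n : ℕ} (g : ℝ≥0) (x : Fin n → ℝ) : Measure (Fin n → ℝ) :=
  Measure.pi fun i => gaussianReal (√(g : ℝ) * x i) 1

instance {n : ℕ} (g : ℝ≥0) (x : Fin n → ℝ) : IsProbabilityMeasure (gLaw g x) := by
  unfold gLaw; infer_instance

def gPn (v : ℝ≥0) (n : ℕ) : Measure (Fin n → ℝ) := Measure.pi fun _ => gaussianReal 0 v

instance (v : ℝ≥0) (n : ℕ) : IsProbabilityMeasure (gPn v n) := by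
  unfold gPn; infer_instance

def gRn (g v : ℝ≥0) {n : ℕ} (x z : Fin n → ℝ) : ℝ≥0 := ∏ i, gR g v (x i) (z i)

theorem gRn_pos (g v : ℝ≥0) {n : ℕ} (x z : Fin n → ℝ) : 0 < gRn g v x z :=
  Finset.prod_pos fun _ _ => gR_pos _ _ _ _

theorem measurable_gRn (g v : ℝ≥0) (n : ℕ) :
    Measurable (fun q : (Fin n → ℝ) × (Fin n → ℝ) => gRn g v q.1 q.2) := by
  have h : ∀ i : Fin n, Measurable
      (fun q : (Fin n → ℝ) × (Fin n → ℝ) => gR g v (q.1 i) (q.2 i)) := by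
    intro i
    have h : Measurable (fun q : (Fin n → ℝ) × (Fin n → ℝ) => (q.1 i, q.2 i)) := by fun_prop
    exact Measurable.comp (g := fun q : ℝ × ℝ => gR g v q.1 q.2) (measurable_gR g v) h
  exact Finset.measurable_fun_prod Finset.univ
    (f := fun (i : Fin n) (q : (Fin n → ℝ) × (Fin n → ℝ)) => gR g v (q.1 i) (q.2 i)) fun i _ => h i

theorem gRn_coe (g v : ℝ≥0) {n : ℕ} (x z : Fin n → ℝ) :
    (gRn g v x z : ℝ≥0∞) = ∏ i, (gR g v (x i) (z i) : ℝ≥0∞) := by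
  unfold gRn; push_cast; rfl

theorem gLaw_eq (g v : ℝ≥0) {n : ℕ} (x : Fin n → ℝ) :
    gLaw g x = (gPn (g * v + 1) n).withDensity (fun z => (gRn g v x z : ℝ≥0∞)) := by
  have hm : ∀ i, Measurable fun z => (gR g v (x i) z : ℝ≥0∞) := fun i =>
    ((measurable_gR g v).comp (measurable_const.prodMk measurable_id)).coe_nnreal_ennreal
  have : ∀ i, SigmaFinite ((gaussianReal 0 (g * v + 1)).withDensity
      (fun z => (gR g v (x i) z : ℝ≥0∞))) := by
    intro i; rw [← gR_withDensity]; infer_instance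
  simp only [gRn_coe, gPn]
  rw [← pi_withDensity_aux (fun _ : Fin n => gaussianReal 0 (g * v + 1))
    (fun i z => (gR g v (x i) z : ℝ≥0∞)) hm]
  unfold gLaw
  congr 1
  funext i
  exact gR_withDensity g v (x i)

theorem gRn_int1 (g v : ℝ≥0) {n : ℕ} (x : Fin n → ℝ) :
    ∫⁻ z, (gRn g v x z : ℝ≥0∞) ∂(gPn (g * v + 1) n) = 1 := by
  have h : (gLaw g x) Set.univ = 1 := measure_univ
  rwa [gLaw_eq g v x, withDensity_apply _ MeasurableSet.univ, Measure.restrict_univ] at h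

theorem gRn_mix (g v : ℝ≥0) (n : ℕ) : ∀ᵐ z ∂(gPn (g * v + 1) n),
    ∫⁻ x, (gRn g v x z : ℝ≥0∞) ∂(gPn v n) = 1 := by
  have h : ∀ i : Fin n, ∀ᵐ z ∂(gPn (g * v + 1) n),
      ∫⁻ x, (gR g v x (z i) : ℝ≥0∞) ∂(gaussianReal 0 v) = 1 := fun i =>
    (measurePreserving_eval (fun _ : Fin n => gaussianReal 0 (g * v + 1)) i).quasiMeasurePreserving.ae
      (gR_mix g v)
  filter_upwards [ae_all_iff.mpr h] with z hz
  simp only [gRn_coe, gPn]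
  rw [lintegral_pi_prod_aux (fun _ : Fin n => gaussianReal 0 v)
    (fun i x => (gR g v x (z i) : ℝ≥0∞)) fun i =>
      ((measurable_gR g v).comp (measurable_id.prodMk measurable_const)).coe_nnreal_ennreal]
  simp [hz]

/-- information per symbol (nats) -/
def gI (g v : ℝ≥0) : ℝ := 1 / 2 * Real.log (1 + g * v)

def gSig (g v : ℝ≥0) : ℝ := √(Var[fun q : ℝ × ℝ => Real.log (gR g v q.1 q.2); gJ g v])

theorem gRn_dev (g v : ℝ≥0) (n : ℕ) :
    ∫⁻ x, ∫⁻ z, (gRn g v x z : ℝ≥0∞) * ENNReal.ofReal |Real.log (gRn g v x z) - n * gI g v|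
      ∂(gPn (g * v + 1) n) ∂(gPn v n) ≤ ENNReal.ofReal (√n * gSig g v) := by
  obtain ⟨hL, hI⟩ := gJ_memLp_integral g v
  have hc := cheb_aux (gJ g v) _ hL n
  rw [hI] at hc
  refine le_trans (le_of_eq ?_) hc
  have hm1 : Measurable fun q : ℝ × ℝ => (gR g v q.1 q.2 : ℝ≥0∞) :=
    (measurable_gR g v).coe_nnreal_ennreal
  have hsf : SigmaFinite (((gaussianReal 0 v).prod (gaussianReal 0 (g * v + 1))).withDensity
    (fun q => (gR g v q.1 q.2 : ℝ≥0∞))) := by rw [gJ_eq]; infer_instance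
  have hpi : (Measure.pi fun _ : Fin n => gJ g v) =
      (Measure.pi fun _ : Fin n => (gaussianReal 0 v).prod (gaussianReal 0 (g * v + 1))).withDensity
        (fun q => ∏ i, (gR g v (q i).1 (q i).2 : ℝ≥0∞)) := by
    rw [← pi_withDensity_aux (fun _ : Fin n => (gaussianReal 0 v).prod (gaussianReal 0 (g * v + 1)))
      (fun i q => (gR g v q.1 q.2 : ℝ≥0∞)) (fun _ => hm1), gJ_eq]
  have mp := measurePreserving_arrowProdEquivProdArrow ℝ ℝ (Fin n)
    (fun _ => gaussianReal 0 v) (fun _ => gaussianReal 0 (g * v + 1))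
  have hmn := measurable_gRn g v n
  let F : (Fin n → ℝ) × (Fin n → ℝ) → ℝ≥0∞ := fun q =>
    (gRn g v q.1 q.2 : ℝ≥0∞) * ENNReal.ofReal |Real.log (gRn g v q.1 q.2) - n * gI g v|
  have hF : Measurable F := by
    refine hmn.coe_nnreal_ennreal.mul ?_
    refine ENNReal.measurable_ofReal.comp ?_
    exact ((Real.measurable_log.comp hmn.coe_nnreal_real).sub_const _).abs
  have e1 : ∫⁻ x, ∫⁻ z, F (x, z) ∂(gPn (g * v + 1) n) ∂(gPn v n) =
      ∫⁻ q, F q ∂((gPn v n).prod (gPn (g * v + 1) n)) := (lintegral_prod _ hF.aemeasurable).symm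
  have e2 := mp.lintegral_comp hF
  have hP : Measurable fun q : Fin n → ℝ × ℝ => ∏ i, (gR g v (q i).1 (q i).2 : ℝ≥0∞) :=
    Finset.measurable_prod _ fun i _ => hm1.comp (measurable_pi_apply i)
  have hA : Measurable fun q : Fin n → ℝ × ℝ =>
      ENNReal.ofReal |∑ i, Real.log (gR g v (q i).1 (q i).2) - n * (1 / 2 * Real.log (1 + g * v))| := by
    refine ENNReal.measurable_ofReal.comp ?_
    refine (Measurable.sub_const ?_ _).abs
    refine Finset.measurable_sum _ fun i _ => ?_
    exact (Real.measurable_log.comp (measurable_gR g v).coe_nnreal_real).comp (measurable_pi_apply i)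
  change ∫⁻ x, ∫⁻ z, F (x, z) ∂(gPn (g * v + 1) n) ∂(gPn v n) = _
  rw [e1, hpi, lintegral_withDensity_eq_lintegral_mul _ hP hA]
  unfold gPn
  rw [← e2]
  refine lintegral_congr fun q => ?_
  have hlog : Real.log (gRn g v (fun i => (q i).1) (fun i => (q i).2)) =
      ∑ i, Real.log (gR g v (q i).1 (q i).2) := by
    unfold gRn
    push_cast
    exact Real.log_prod fun i _ => (NNReal.coe_pos.mpr (gR_pos _ _ _ _)).ne'
  have hq : (MeasurableEquiv.arrowProdEquivProdArrow ℝ ℝ (Fin n)) q =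
    (fun i => (q i).1, fun i => (q i).2) := rfl
  simp only [F, hq, Pi.mul_apply, hlog, gRn_coe, gI]

/-! ### Truncation to the power constraint -/

def powS (P : ℝ) (n : ℕ) : Set (Fin n → ℝ) := {x | ∑ i, x i ^ 2 ≤ n * P}

theorem measurableSet_powS (P : ℝ) (n : ℕ) : MeasurableSet (powS P n) :=
  measurableSet_le (by fun_prop) measurable_const

theorem powS_large (v : ℝ≥0) (P : ℝ) (hvP : v < P) :
    ∀ᶠ n : ℕ in Filter.atTop, (2 : ℝ≥0∞)⁻¹ ≤ gPn v n (powS P n) := by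
  set s := √(Var[fun x : ℝ => x ^ 2; gaussianReal 0 v]) with hs
  have hs0 : 0 ≤ s := Real.sqrt_nonneg _
  have hlim : Filter.Tendsto (fun n : ℕ => √(n : ℝ)) Filter.atTop Filter.atTop :=
    Real.tendsto_sqrt_atTop.comp tendsto_natCast_atTop_atTop
  filter_upwards [hlim.eventually_ge_atTop (2 * s / (P - v)), Filter.eventually_gt_atTop 0] with n hn hn0
  have hd : 0 < P - v := by linarith
  have hnR : (0 : ℝ) < n := by exact_mod_cast hn0
  have hsq : 0 < √(n : ℝ) := Real.sqrt_pos.mpr hnR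
  have hc := cheb_aux (gaussianReal 0 v) _ (memLp_sq_gaussian v) n
  rw [integral_sq_gaussian, ← hs] at hc
  have hM := mul_meas_ge_le_lintegral (μ := Measure.pi fun _ : Fin n => gaussianReal 0 v)
    (f := fun x => ENNReal.ofReal |∑ i, x i ^ 2 - n * v|)
    (ENNReal.measurable_ofReal.comp (by fun_prop)) (ENNReal.ofReal (n * (P - v)))
  have hsub : (powS P n)ᶜ ⊆ {x | ENNReal.ofReal (n * (P - v)) ≤ ENNReal.ofReal |∑ i, x i ^ 2 - n * v|} := by
    intro x hx
    simp only [powS, Set.mem_compl_iff, Set.mem_ofPred_eq, not_le] at hx ⊢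
    refine ENNReal.ofReal_le_ofReal (le_trans ?_ (le_abs_self _))
    linarith
  have h1 : ENNReal.ofReal (n * (P - v)) * gPn v n (powS P n)ᶜ ≤ ENNReal.ofReal (√n * s) :=
    (mul_le_mul_right (measure_mono hsub) _).trans (hM.trans hc)
  have h2 : gPn v n (powS P n)ᶜ ≤ 2⁻¹ := by
    have h3 : ENNReal.ofReal (√n * s) ≤ ENNReal.ofReal (n * (P - v)) * 2⁻¹ := by
      rw [show (2 : ℝ≥0∞)⁻¹ = ENNReal.ofReal (2⁻¹) by
        rw [ENNReal.ofReal_inv_of_pos (by norm_num)]; simp, ← ENNReal.ofReal_mul (by positivity)]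
      refine ENNReal.ofReal_le_ofReal ?_
      rw [div_le_iff₀ hd] at hn
      have := Real.mul_self_sqrt hnR.le
      nlinarith
    have h4 := h1.trans h3
    have h0 : ENNReal.ofReal (n * (P - v)) ≠ 0 := by
      simp only [ne_eq, ENNReal.ofReal_eq_zero, not_le]; positivity
    exact (ENNReal.mul_le_mul_iff_right h0 ENNReal.ofReal_ne_top).mp h4
  have h5 := prob_compl_eq_one_sub (μ := gPn v n) (measurableSet_powS P n)
  rw [h5] at h2
  rw [tsub_le_iff_right] at h2
  have h6 : (2 : ℝ≥0∞)⁻¹ + 2⁻¹ ≤ 2⁻¹ + gPn v n (powS P n) := by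
    rw [ENNReal.inv_two_add_inv_two]; exact h2
  exact (ENNReal.add_le_add_iff_left (by simp)).mp h6

/-- truncated Gaussian input -/
def gTr (v : ℝ≥0) (P : ℝ) (n : ℕ) : Measure (Fin n → ℝ) :=
  (gPn v n (powS P n))⁻¹ • (gPn v n).restrict (powS P n)

theorem gTr_prob (v : ℝ≥0) (P : ℝ) (n : ℕ) (h : (2 : ℝ≥0∞)⁻¹ ≤ gPn v n (powS P n)) :
    IsProbabilityMeasure (gTr v P n) := by
  constructor
  simp only [gTr, Measure.smul_apply, smul_eq_mul, Measure.restrict_apply_univ]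
  refine ENNReal.inv_mul_cancel ?_ (measure_ne_top _ _)
  intro h0
  rw [h0] at h
  simp at h

theorem gTr_compl (v : ℝ≥0) (P : ℝ) (n : ℕ) : gTr v P n (powS P n)ᶜ = 0 := by
  simp only [gTr, Measure.smul_apply, smul_eq_mul]
  rw [Measure.restrict_apply (measurableSet_powS P n).compl]
  simp

theorem gTr_le (v : ℝ≥0) (P : ℝ) (n : ℕ) (h : (2 : ℝ≥0∞)⁻¹ ≤ gPn v n (powS P n))
    (f : (Fin n → ℝ) → ℝ≥0∞) : ∫⁻ x, f x ∂(gTr v P n) ≤ 2 * ∫⁻ x, f x ∂(gPn v n) := by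
  rw [gTr, lintegral_smul_measure, smul_eq_mul]
  exact mul_le_mul' (ENNReal.inv_le_iff_inv_le.mp h) (setLIntegral_le_lintegral _ _)

theorem gTr_chan (g v : ℝ≥0) (P : ℝ) (n : ℕ) (h : (2 : ℝ≥0∞)⁻¹ ≤ gPn v n (powS P n)) :
    Chan (gTr v P n) (gPn (g * v + 1) n) (gRn g v) := by
  refine ⟨measurable_gRn g v n, gRn_int1 g v, ?_⟩
  filter_upwards [gRn_mix g v n] with z hz
  refine (gTr_le v P n h _).trans ?_
  rw [hz, mul_one]

theorem gTr_dev (g v : ℝ≥0) (P : ℝ) (n : ℕ) (h : (2 : ℝ≥0∞)⁻¹ ≤ gPn v n (powS P n)) :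
    ∫⁻ x, ∫⁻ z, (gRn g v x z : ℝ≥0∞) * ENNReal.ofReal |Real.log (gRn g v x z) - n * gI g v|
      ∂(gPn (g * v + 1) n) ∂(gTr v P n) ≤ ENNReal.ofReal (2 * (√n * gSig g v)) := by
  refine (gTr_le v P n h _).trans ?_
  rw [ENNReal.ofReal_mul (by norm_num), ENNReal.ofReal_ofNat]
  exact mul_le_mul_right (gRn_dev g v n) _

theorem gTr_resolv (g v : ℝ≥0) (P : ℝ) (n : ℕ) (h : (2 : ℝ≥0∞)⁻¹ ≤ gPn v n (powS P n))
    (W : ℕ) (hW : Real.exp (n * gI g v) ≤ W) :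
    ∫⁻ x, ∫⁻ z, (gRn g v x z : ℝ≥0∞) * ell (gRn g v x z / W)
      ∂(gPn (g * v + 1) n) ∂(gTr v P n) ≤
      ENNReal.ofReal (Real.log 2 + 2 * (√n * gSig g v)) := by
  have := gTr_prob v P n h
  have hW0 : (0 : ℝ) < W := lt_of_lt_of_le (Real.exp_pos _) hW
  have hpt : ∀ x z : Fin n → ℝ, (gRn g v x z : ℝ≥0∞) * ell (gRn g v x z / W) ≤
      (gRn g v x z : ℝ≥0∞) * ENNReal.ofReal (Real.log 2) +
      (gRn g v x z : ℝ≥0∞) * ENNReal.ofReal |Real.log (gRn g v x z) - n * gI g v| := by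
    intro x z
    rw [← mul_add, ← ENNReal.ofReal_add (Real.log_nonneg (by norm_num)) (abs_nonneg _)]
    refine mul_le_mul_right (ENNReal.ofReal_le_ofReal ?_) _
    have hr : (0 : ℝ) < gRn g v x z := NNReal.coe_pos.mpr (gRn_pos _ _ _ _)
    push_cast
    set u := |Real.log (gRn g v x z) - n * gI g v| with hu
    have h1 : (gRn g v x z : ℝ) / W ≤ Real.exp u := by
      calc (gRn g v x z : ℝ) / W ≤ gRn g v x z / Real.exp (n * gI g v) := by gcongr
        _ = Real.exp (Real.log (gRn g v x z) - n * gI g v) := by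
            rw [Real.exp_sub, Real.exp_log hr]
        _ ≤ _ := Real.exp_le_exp.mpr (le_abs_self _)
    have h2 : (1 : ℝ) ≤ Real.exp u := Real.one_le_exp (abs_nonneg _)
    calc Real.log (1 + gRn g v x z / W) ≤ Real.log (2 * Real.exp u) := by
          apply Real.log_le_log
          · positivity
          · linarith
      _ = Real.log 2 + u := by rw [Real.log_mul (by norm_num) (Real.exp_pos _).ne', Real.log_exp]
  have hmx : ∀ x, Measurable fun z => (gRn g v x z : ℝ≥0∞) := fun x =>
    ((measurable_gRn g v n).comp (measurable_const.prodMk measurable_id)).coe_nnreal_ennreal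
  have hstep : ∀ x, ∫⁻ z, (gRn g v x z : ℝ≥0∞) * ell (gRn g v x z / W) ∂(gPn (g * v + 1) n) ≤
      ENNReal.ofReal (Real.log 2) +
      ∫⁻ z, (gRn g v x z : ℝ≥0∞) * ENNReal.ofReal |Real.log (gRn g v x z) - n * gI g v|
      ∂(gPn (g * v + 1) n) := by
    intro x
    refine (lintegral_mono (hpt x)).trans ?_
    rw [lintegral_add_left ((hmx x).mul_const _), lintegral_mul_const _ (hmx x), gRn_int1, one_mul]
  refine (lintegral_mono hstep).trans ?_
  rw [lintegral_add_left measurable_const, lintegral_const, measure_univ, mul_one,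
    ENNReal.ofReal_add (Real.log_nonneg (by norm_num)) (by unfold gSig; positivity)]
  exact add_le_add le_rfl (gTr_dev g v P n h)

theorem gTr_lo (g v : ℝ≥0) (P : ℝ) (n : ℕ) (hn : 0 < n) (h : (2 : ℝ≥0∞)⁻¹ ≤ gPn v n (powS P n))
    (δ : ℝ) (hδ : 0 < δ) :
    ∫⁻ x, ∫⁻ z, (gRn g v x z : ℝ≥0∞) * loI (Real.exp (n * (gI g v - δ))).toNNReal (gRn g v x z)
      ∂(gPn (g * v + 1) n) ∂(gTr v P n) ≤
      ENNReal.ofReal (2 * (√n * gSig g v) / (n * δ)) := by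
  have hnR : (0 : ℝ) < n := by exact_mod_cast hn
  have hnd : 0 < n * δ := by positivity
  have hfin : (ENNReal.ofReal (n * δ))⁻¹ ≠ ⊤ := by
    rw [ne_eq, ENNReal.inv_eq_top, ENNReal.ofReal_eq_zero, not_le]; exact hnd
  have hpt : ∀ x z : Fin n → ℝ, (gRn g v x z : ℝ≥0∞) * loI (Real.exp (n * (gI g v - δ))).toNNReal (gRn g v x z) ≤
      (ENNReal.ofReal (n * δ))⁻¹ * ((gRn g v x z : ℝ≥0∞) *
        ENNReal.ofReal |Real.log (gRn g v x z) - n * gI g v|) := by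
    intro x z
    have hr : (0 : ℝ) < gRn g v x z := NNReal.coe_pos.mpr (gRn_pos _ _ _ _)
    rw [mul_left_comm]
    refine mul_le_mul_right ?_ _
    unfold loI
    split_ifs with hle
    · rw [← ENNReal.ofReal_inv_of_pos hnd, ← ENNReal.ofReal_mul (by positivity), ← ENNReal.ofReal_one]
      refine ENNReal.ofReal_le_ofReal ?_
      rw [← div_eq_inv_mul, one_le_div hnd]
      have h1 : (gRn g v x z : ℝ) ≤ Real.exp (n * (gI g v - δ)) :=
        (Real.le_toNNReal_iff_coe_le (Real.exp_pos _).le).mp hle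
      have h2 : Real.log (gRn g v x z) ≤ n * (gI g v - δ) := by
        rw [Real.log_le_iff_le_exp hr]; exact h1
      refine le_trans ?_ (neg_le_abs _)
      linarith
    · exact zero_le
  have hstep : ∀ x, ∫⁻ z, (gRn g v x z : ℝ≥0∞) * loI (Real.exp (n * (gI g v - δ))).toNNReal (gRn g v x z) ∂(gPn (g * v + 1) n) ≤
      (ENNReal.ofReal (n * δ))⁻¹ *
      ∫⁻ z, (gRn g v x z : ℝ≥0∞) * ENNReal.ofReal |Real.log (gRn g v x z) - n * gI g v|
      ∂(gPn (g * v + 1) n) := by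
    intro x
    refine (lintegral_mono (hpt x)).trans ?_
    rw [lintegral_const_mul' _ _ hfin]
  refine (lintegral_mono hstep).trans ?_
  rw [lintegral_const_mul' _ _ hfin, div_eq_inv_mul,
    ENNReal.ofReal_mul (p := (n * δ)⁻¹) (by positivity), ENNReal.ofReal_inv_of_pos hnd]
  exact mul_le_mul_right (gTr_dev g v P n h) _



/-! ### Scalar wiretap codes -/

/-- A good scalar two-level wiretap code. -/
def Good (a b1 b2 : ℝ≥0) (P η : ℝ) (n K1 K2 W : ℕ) : Prop :=
  ∃ c : Fin K1 × Fin K2 × Fin W → (Fin n → ℝ), (∀ j, ∑ i, c j i ^ 2 ≤ n * P) ∧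
    (∃ dec : (Fin n → ℝ) → Fin K1 × Fin K2, Measurable dec ∧
      (Fintype.card (Fin K1 × Fin K2 × Fin W) : ℝ≥0∞)⁻¹ *
        ∑ j, gLaw a (c j) {z | dec z ≠ (j.1, j.2.1)} ≤ ENNReal.ofReal η) ∧
    Leak (fun m : Fin K1 × Fin K2 => avgM fun w : Fin W => gLaw b2 (c (m.1, m.2, w)))
      (ENNReal.ofReal (n * η)) ∧
    Leak (fun m : Fin K1 => avgM fun w : Fin K2 × Fin W => gLaw b1 (c (m, w)))
      (ENNReal.ofReal (n * η))

theorem gSig_nonneg (g v : ℝ≥0) : 0 ≤ gSig g v := Real.sqrt_nonneg _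

theorem core_tendsto (s0 s1 s2 δ : ℝ) (hδ : 0 < δ) :
    Filter.Tendsto (fun n : ℕ => 2 * (√(n : ℝ) * s0) / (n * δ) + 2 * Real.exp (-(n * δ)) +
      (n : ℝ)⁻¹ * (Real.log 2 + 2 * (√(n : ℝ) * s2) + 2) +
      (n : ℝ)⁻¹ * (Real.log 2 + 2 * (√(n : ℝ) * s1) + 2)) Filter.atTop (nhds 0) := by
  have t1 : Filter.Tendsto (fun n : ℕ => (n : ℝ)⁻¹) Filter.atTop (nhds 0) :=
    tendsto_inv_atTop_nhds_zero_nat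
  have t2 : Filter.Tendsto (fun n : ℕ => (√(n : ℝ))⁻¹) Filter.atTop (nhds 0) :=
    (Real.tendsto_sqrt_atTop.comp tendsto_natCast_atTop_atTop).inv_tendsto_atTop
  have t3 : Filter.Tendsto (fun n : ℕ => Real.exp (-(n * δ))) Filter.atTop (nhds 0) :=
    Real.tendsto_exp_neg_atTop_nhds_zero.comp
      (Filter.Tendsto.atTop_mul_const hδ tendsto_natCast_atTop_atTop)
  have key := (((t2.const_mul (2 * s0 / δ)).add (t3.const_mul 2)).add
    ((t1.const_mul (Real.log 2 + 2)).add (t2.const_mul (2 * s2)))).add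
    ((t1.const_mul (Real.log 2 + 2)).add (t2.const_mul (2 * s1)))
  simp only [mul_zero, add_zero] at key
  refine key.congr' ?_
  filter_upwards [Filter.eventually_gt_atTop 0] with n hn
  have hnR : (0 : ℝ) < n := by exact_mod_cast hn
  have hs : 0 < √(n : ℝ) := Real.sqrt_pos.mpr hnR
  have hsq : √(n : ℝ) / n = (√(n : ℝ))⁻¹ := by
    rw [div_eq_iff hnR.ne', eq_comm, inv_mul_eq_iff_eq_mul₀ hs.ne', Real.mul_self_sqrt hnR.le]
  have h2 : ∀ s, (n : ℝ)⁻¹ * (Real.log 2 + 2 * (√(n : ℝ) * s) + 2) =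
      (Real.log 2 + 2) * (n : ℝ)⁻¹ + 2 * s * (√(n : ℝ))⁻¹ := by
    intro s; rw [← hsq]; ring
  rw [h2, h2, ← hsq]
  field_simp

theorem core_code (a b1 b2 v : ℝ≥0) (P δ η : ℝ) (hvP : v < P) (hδ : 0 < δ) (hη : 0 < η) :
    ∀ᶠ n : ℕ in Filter.atTop, ∀ K1 K2 W : ℕ, 0 < K1 → 0 < K2 → 0 < W →
      Real.exp (n * gI b2 v) ≤ W → Real.exp (n * gI b1 v) ≤ K2 * W →
      (K1 : ℝ) * (K2 * W) ≤ Real.exp (n * (gI a v - 2 * δ)) → Good a b1 b2 P η n K1 K2 W := by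
  filter_upwards [(core_tendsto (gSig a v) (gSig b1 v) (gSig b2 v) δ hδ).eventually_le_const hη,
    powS_large v P hvP, Filter.eventually_gt_atTop 0] with n hE hS hn K1 K2 W hK1 hK2 hW h2 h1 ha
  have hnR : (0 : ℝ) < n := by exact_mod_cast hn
  have : NeZero K1 := ⟨hK1.ne'⟩
  have : NeZero K2 := ⟨hK2.ne'⟩
  have : NeZero W := ⟨hW.ne'⟩
  have := gTr_prob v P n hS
  set τ : ℝ≥0 := (Real.exp (n * (gI a v - δ))).toNNReal with hτ
  have hτ0 : 0 < τ := Real.toNNReal_pos.mpr (Real.exp_pos _)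
  have hτc : (τ : ℝ≥0∞) = ENNReal.ofReal (Real.exp (n * (gI a v - δ))) := rfl
  have sa := gSig_nonneg a v
  have s1 := gSig_nonneg b1 v
  have s2 := gSig_nonneg b2 v
  have hl2 : 0 ≤ Real.log 2 := Real.log_nonneg (by norm_num)
  have b0 : (Fintype.card (Fin K1 × Fin K2 × Fin W) : ℝ≥0∞) * (2 * (τ : ℝ≥0∞)⁻¹) ≤
      ENNReal.ofReal (2 * Real.exp (-(n * δ))) := by
    rw [hτc, ← ENNReal.ofReal_inv_of_pos (Real.exp_pos _), ← ENNReal.ofReal_ofNat 2,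
      ← ENNReal.ofReal_mul (by norm_num), ← ENNReal.ofReal_natCast,
      ← ENNReal.ofReal_mul (by positivity)]
    refine ENNReal.ofReal_le_ofReal ?_
    simp only [Fintype.card_prod, Fintype.card_fin, Nat.cast_mul]
    rw [← Real.exp_neg]
    calc (K1 : ℝ) * (K2 * W) * (2 * Real.exp (-(n * (gI a v - δ)))) ≤
        Real.exp (n * (gI a v - 2 * δ)) * (2 * Real.exp (-(n * (gI a v - δ)))) := by gcongr
      _ = 2 * Real.exp (n * (gI a v - 2 * δ) + -(n * (gI a v - δ))) := by
          rw [Real.exp_add]; ring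
      _ = _ := by congr 2; ring
  have two : (2 : ℝ≥0∞) = ENNReal.ofReal 2 := by simp
  have bE : ((∫⁻ x, ∫⁻ z, gRn a v x z * loI τ (gRn a v x z) ∂(gPn (a * v + 1) n) ∂(gTr v P n)) +
        Fintype.card (Fin K1 × Fin K2 × Fin W) * (2 * (τ : ℝ≥0∞)⁻¹)) +
      ENNReal.ofReal ((n : ℝ)⁻¹) * ((∫⁻ x, ∫⁻ z, gRn b2 v x z * ell (gRn b2 v x z / Fintype.card (Fin W))
        ∂(gPn (b2 * v + 1) n) ∂(gTr v P n)) + 2) +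
      ENNReal.ofReal ((n : ℝ)⁻¹) * ((∫⁻ x, ∫⁻ z, gRn b1 v x z * ell (gRn b1 v x z / Fintype.card (Fin K2 × Fin W))
        ∂(gPn (b1 * v + 1) n) ∂(gTr v P n)) + 2) ≤ ENNReal.ofReal η := by
    have r2 := gTr_resolv b2 v P n hS (Fintype.card (Fin W)) (by simpa using h2)
    have r1 := gTr_resolv b1 v P n hS (Fintype.card (Fin K2 × Fin W)) (by simpa using h1)
    have r0 := gTr_lo a v P n hn hS δ hδ
    rw [← hτ] at r0
    refine le_trans (add_le_add (add_le_add (add_le_add r0 b0) (mul_le_mul_right (add_le_add r2 le_rfl) _))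
      (mul_le_mul_right (add_le_add r1 le_rfl) _)) ?_
    rw [two, ← ENNReal.ofReal_add (by positivity) (by positivity),
      ← ENNReal.ofReal_add (by positivity) (by positivity),
      ← ENNReal.ofReal_add (by positivity) (by positivity),
      ← ENNReal.ofReal_mul (by positivity), ← ENNReal.ofReal_mul (by positivity),
      ← ENNReal.ofReal_add (by positivity) (by positivity),
      ← ENNReal.ofReal_add (by positivity) (by positivity)]
    exact ENNReal.ofReal_le_ofReal hE
  obtain ⟨c, hc, ⟨dec, hd, hde⟩, hL2, hL1⟩ := exists_code (A := Fin K1) (B := Fin K2) (C := Fin W)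
    (gTr v P n) (powS P n) (gTr_compl v P n) (gPn (a * v + 1) n) (gPn (b2 * v + 1) n)
    (gPn (b1 * v + 1) n) (gRn a v) (gRn b2 v) (gRn b1 v) (gTr_chan a v P n hS) (gTr_chan b2 v P n hS)
    (gTr_chan b1 v P n hS) τ hτ0 (ENNReal.ofReal ((n : ℝ)⁻¹))
    (by rw [ne_eq, ENNReal.ofReal_eq_zero, not_le]; positivity) ENNReal.ofReal_ne_top
    (ENNReal.ofReal η) bE
  have hsc : (ENNReal.ofReal ((n : ℝ)⁻¹))⁻¹ * ENNReal.ofReal η = ENNReal.ofReal (n * η) := by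
    rw [← ENNReal.ofReal_inv_of_pos (by positivity), inv_inv, ← ENNReal.ofReal_mul hnR.le]
  rw [hsc] at hL2 hL1
  simp only [← gLaw_eq] at hde hL2 hL1
  refine ⟨c, hc, ⟨fun z => ((dec z).1, (dec z).2.1), by fun_prop, ?_⟩, hL2, hL1⟩
  refine le_trans (mul_le_mul_right (Finset.sum_le_sum fun j _ => measure_mono ?_) _) hde
  intro z hz hcon
  apply hz
  simp only [hcon]



/-! ### The scalar coding theorem -/

/-- half log SNR in nats -/
def gG (g : ℝ≥0) (P : ℝ) : ℝ := 1 / 2 * Real.log (1 + g * P)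

theorem ceil_exp_le {x : ℝ} (hx : 0 ≤ x) : ((⌈Real.exp x⌉₊ : ℕ) : ℝ) ≤ 2 * Real.exp x := by
  have h1 : 1 ≤ Real.exp x := Real.one_le_exp hx
  have h2 := Nat.ceil_lt_add_one (Real.exp_pos x).le
  linarith

theorem ceil_code (a b1 b2 v : ℝ≥0) (P δ η : ℝ) (hvP : v < P) (hδ : 0 < δ) (hη : 0 < η)
    (r1 r2 r0 : ℝ) (h1 : 0 ≤ r1) (h2 : 0 ≤ r2) (h0 : 0 ≤ r0) (hr0 : gI b2 v ≤ r0)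
    (hr2 : gI b1 v ≤ r2 + r0) (hr : r1 + r2 + r0 ≤ gI a v - 3 * δ) :
    ∀ᶠ n : ℕ in Filter.atTop, Good a b1 b2 P η n ⌈Real.exp (n * r1)⌉₊ ⌈Real.exp (n * r2)⌉₊
      ⌈Real.exp (n * r0)⌉₊ := by
  have hbig : ∀ᶠ n : ℕ in Filter.atTop, Real.log 8 ≤ n * δ :=
    (Filter.Tendsto.atTop_mul_const hδ tendsto_natCast_atTop_atTop).eventually_ge_atTop _
  filter_upwards [core_code a b1 b2 v P δ η hvP hδ hη, hbig] with n hn hb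
  have hn0 : (0 : ℝ) ≤ n := Nat.cast_nonneg n
  refine hn _ _ _ (Nat.ceil_pos.2 (Real.exp_pos _)) (Nat.ceil_pos.2 (Real.exp_pos _))
    (Nat.ceil_pos.2 (Real.exp_pos _)) ?_ ?_ ?_
  · exact le_trans (Real.exp_le_exp.2 (by gcongr)) (Nat.le_ceil _)
  · calc Real.exp (n * gI b1 v) ≤ Real.exp (n * r2) * Real.exp (n * r0) := by
          rw [← Real.exp_add]; exact Real.exp_le_exp.2 (by nlinarith)
      _ ≤ _ := by gcongr <;> exact Nat.le_ceil _
  · calc _ ≤ (2 * Real.exp (n * r1)) * ((2 * Real.exp (n * r2)) * (2 * Real.exp (n * r0))) := by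
          gcongr <;> exact ceil_exp_le (by positivity)
      _ = 8 * Real.exp (n * (r1 + r2 + r0)) := by
          rw [mul_add, mul_add, Real.exp_add, Real.exp_add]; ring
      _ = Real.exp (Real.log 8 + n * (r1 + r2 + r0)) := by
          rw [Real.exp_add, Real.exp_log (by norm_num)]
      _ ≤ _ := Real.exp_le_exp.2 (by nlinarith)

theorem exists_v (a b1 b2 : ℝ≥0) (P δ : ℝ) (hP : 0 < P) (hδ : 0 < δ) :
    ∃ v : ℝ≥0, v < P ∧ |gI a v - gG a P| < δ ∧ |gI b1 v - gG b1 P| < δ ∧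
      |gI b2 v - gG b2 P| < δ := by
  have key : ∀ g : ℝ≥0, ∀ᶠ t in nhdsWithin P (Set.Iio P),
      |1 / 2 * Real.log (1 + g * t) - gG g P| < δ := by
    intro g
    have hc : ContinuousAt (fun t : ℝ => 1 / 2 * Real.log (1 + g * t)) P := by
      refine ContinuousAt.mul continuousAt_const (ContinuousAt.log (by fun_prop) ?_)
      positivity
    have := Metric.tendsto_nhds.1 hc.tendsto δ hδ
    exact (this.filter_mono nhdsWithin_le_nhds)
  have hp : ∀ᶠ t in nhdsWithin P (Set.Iio P), 0 < t :=
    (eventually_gt_nhds hP).filter_mono nhdsWithin_le_nhds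
  have hlt : ∀ᶠ t in nhdsWithin P (Set.Iio P), t < P := eventually_mem_nhdsWithin
  obtain ⟨t, h1, h2, h3, h4, h5⟩ :=
    ((key a).and ((key b1).and ((key b2).and (hp.and hlt)))).exists
  exact ⟨⟨t, h4.le⟩, h5, h1, h2, h3⟩

theorem Cs_eq (P : ℝ) (a b : ℝ≥0) : Cs P a b = max 0 ((gG a P - gG b P) / Real.log 2) := by
  unfold Cs gG Real.logb
  congr 1; ring

theorem rate_aux {n : ℕ} {r R : ℝ} (h : R * Real.log 2 ≤ r) :
    (n : ℝ) * R ≤ Real.logb 2 (⌈Real.exp (n * r)⌉₊ : ℕ) := by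
  have hl : 0 < Real.log 2 := Real.log_pos (by norm_num)
  rw [Real.logb, le_div_iff₀ hl]
  calc (n : ℝ) * R * Real.log 2 = n * (R * Real.log 2) := by ring
    _ ≤ n * r := by gcongr
    _ = Real.log (Real.exp (n * r)) := (Real.log_exp _).symm
    _ ≤ _ := Real.log_le_log (Real.exp_pos _) (Nat.le_ceil _)

theorem gG_mono {a b : ℝ≥0} {P : ℝ} (hP : 0 ≤ P) (h : a ≤ b) : gG a P ≤ gG b P := by
  unfold gG
  have : (a : ℝ) ≤ b := by exact_mod_cast h
  have h2 : Real.log (1 + a * P) ≤ Real.log (1 + b * P) :=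
    Real.log_le_log (by positivity) (by gcongr)
  linarith

theorem gI_mono {a b v : ℝ≥0} (h : a ≤ b) : gI a v ≤ gI b v := gG_mono v.2 h

theorem gI_nonneg (a v : ℝ≥0) : 0 ≤ gI a v := by
  unfold gI
  have : 0 ≤ Real.log (1 + a * v) := Real.log_nonneg (by
    have : (0 : ℝ) ≤ a * v := by positivity
    linarith)
  linarith

theorem ev_log2 {η : ℝ} (hη : 0 < η) : ∀ᶠ n : ℕ in Filter.atTop, Real.log 2 ≤ n * η :=
  (Filter.Tendsto.atTop_mul_const hη tendsto_natCast_atTop_atTop).eventually_ge_atTop _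

theorem scalar_code (a b1 b2 : ℝ≥0) (hb : b2 ≤ b1) (P ε : ℝ) (hP : 0 ≤ P) (hε : 0 < ε) :
    ∀ᶠ n : ℕ in Filter.atTop, ∃ K1 K2 W : ℕ, 0 < K1 ∧ 0 < K2 ∧ 0 < W ∧
      n * (Cs P a b1 - ε) ≤ Real.logb 2 K1 ∧ n * (Cs P a b2 - Cs P a b1 - ε) ≤ Real.logb 2 K2 ∧
      Good a b1 b2 P ε n K1 K2 W := by
  have hl : 0 < Real.log 2 := Real.log_pos (by norm_num)
  have hmono := gG_mono hP hb
  have cs0 : ∀ b : ℝ≥0, gG a P ≤ gG b P → Cs P a b = 0 := by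
    intro b h
    rw [Cs_eq, max_eq_left]
    exact div_nonpos_of_nonpos_of_nonneg (by linarith) hl.le
  have cs1 : ∀ b : ℝ≥0, gG b P ≤ gG a P → Cs P a b * Real.log 2 = gG a P - gG b P := by
    intro b h
    rw [Cs_eq, max_eq_right (div_nonneg (by linarith) hl.le), div_mul_cancel₀ _ hl.ne']
  rcases le_or_gt (gG a P) (gG b2 P) with hc | hc
  · -- zero rate
    filter_upwards [ev_log2 hε] with n hn
    refine ⟨1, 1, 1, one_pos, one_pos, one_pos, ?_, ?_, ?_⟩
    · rw [cs0 b1 (hc.trans hmono)]; simp only [Nat.cast_one, Real.logb_one]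
      have : (0 : ℝ) ≤ n * ε := by positivity
      linarith
    · rw [cs0 b1 (hc.trans hmono), cs0 b2 hc]; simp only [Nat.cast_one, Real.logb_one]
      have : (0 : ℝ) ≤ n * ε := by positivity
      linarith
    · refine ⟨fun _ _ => 0, ?_, ⟨fun _ => (0, 0), measurable_const, ?_⟩, ?_, ?_⟩
      · intro j; simp; positivity
      · have : ∀ j : Fin 1 × Fin 1 × Fin 1,
            gLaw a (fun _ : Fin n => (0 : ℝ)) {z | ((0, 0) : Fin 1 × Fin 1) ≠ (j.1, j.2.1)} = 0 := by
          intro j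
          rw [show {z : Fin n → ℝ | ((0, 0) : Fin 1 × Fin 1) ≠ (j.1, j.2.1)} = ∅ from ?_]
          · simp
          · ext z; simp [eq_iff_true_of_subsingleton]
        simp only [this]; simp
      · exact (leak_const _ (gLaw b2 fun _ => 0) (fun m => by
          ext s hs; rw [avgM_apply]; simp)).mono (ENNReal.ofReal_le_ofReal hn)
      · exact (leak_const _ (gLaw b1 fun _ => 0) (fun m => by
          ext s hs; rw [avgM_apply]; simp)).mono (ENNReal.ofReal_le_ofReal hn)
  have hP0 : 0 < P := by
    rcases hP.lt_or_eq with h | h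
    · exact h
    · exfalso; rw [← h] at hc; simp [gG] at hc
  rcases le_or_gt (gG a P) (gG b1 P) with hc1 | hc1
  · set D := gG a P - gG b2 P with hD
    have hD0 : 0 < D := by linarith
    set δ := min D (ε * Real.log 2) / 10 with hδdef
    have hδ : 0 < δ := by positivity
    have hδD : 10 * δ ≤ D := by rw [hδdef]; linarith [min_le_left D (ε * Real.log 2)]
    have hδε : 10 * δ ≤ ε * Real.log 2 := by rw [hδdef]; linarith [min_le_right D (ε * Real.log 2)]
    obtain ⟨v, hv, hva, -, hv2⟩ := exists_v a b1 b2 P δ hP0 hδ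
    rw [abs_lt] at hva hv2
    have hc0 : gI 0 v = 0 := by simp [gI]
    have := ceil_code a 0 b2 v P δ ε hv hδ hε 0 (gI a v - gI b2 v - 3 * δ) (gI b2 v) le_rfl
      (by linarith) (gI_nonneg _ _) le_rfl (by rw [hc0]; linarith [gI_nonneg b2 v, gI_nonneg a v, hva.1, hD, gG_mono hP (zero_le : (0:ℝ≥0) ≤ b2), (show gG 0 P = 0 by simp [gG])]) (by linarith)
    filter_upwards [this, ev_log2 hε] with n hn hn2
    refine ⟨⌈Real.exp (n * 0)⌉₊, _, ⌈Real.exp (n * gI b2 v)⌉₊, Nat.ceil_pos.2 (Real.exp_pos _),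
      Nat.ceil_pos.2 (Real.exp_pos _), Nat.ceil_pos.2 (Real.exp_pos _), ?_,
      rate_aux (r := gI a v - gI b2 v - 3 * δ) ?_, ?_⟩
    · rw [cs0 b1 hc1]
      exact rate_aux (by nlinarith)
    · rw [cs0 b1 hc1]
      have := cs1 b2 hc.le
      nlinarith
    · obtain ⟨c, hc, hdec, hl2, -⟩ := hn
      refine ⟨c, hc, hdec, hl2, ?_⟩
      have h1 : ⌈Real.exp ((n : ℝ) * 0)⌉₊ = 1 := by simp
      have hss : Subsingleton (Fin ⌈Real.exp ((n : ℝ) * 0)⌉₊) := by rw [h1]; infer_instance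
      have m0 : Fin ⌈Real.exp ((n : ℝ) * 0)⌉₊ := ⟨0, by rw [h1]; exact one_pos⟩
      have : Nonempty (Fin ⌈Real.exp ((n : ℝ) * 0)⌉₊) := ⟨m0⟩
      have p2 : ∀ x : ℝ, Nonempty (Fin ⌈Real.exp x⌉₊) :=
        fun x => ⟨⟨0, Nat.ceil_pos.2 (Real.exp_pos _)⟩⟩
      have := p2 (n * (gI a v - gI b2 v - 3 * δ))
      have := p2 (n * gI b2 v)
      exact (leak_const _ _ (fun m => by rw [Subsingleton.elim m m0])).mono
        (ENNReal.ofReal_le_ofReal hn2)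
  · set D := gG a P - gG b1 P with hD
    have hD0 : 0 < D := by linarith
    set δ := min D (ε * Real.log 2) / 10 with hδdef
    have hδ : 0 < δ := by positivity
    have hδD : 10 * δ ≤ D := by rw [hδdef]; linarith [min_le_left D (ε * Real.log 2)]
    have hδε : 10 * δ ≤ ε * Real.log 2 := by rw [hδdef]; linarith [min_le_right D (ε * Real.log 2)]
    obtain ⟨v, hv, hva, hv1, hv2⟩ := exists_v a b1 b2 P δ hP0 hδ
    rw [abs_lt] at hva hv1 hv2
    have hm : gI b2 v ≤ gI b1 v := gI_mono hb
    have := ceil_code a b1 b2 v P δ ε hv hδ hε (gI a v - gI b1 v - 3 * δ) (gI b1 v - gI b2 v)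
      (gI b2 v) (by linarith) (by linarith) (gI_nonneg _ _) le_rfl (by linarith) (by linarith)
    filter_upwards [this] with n hn
    have e1 := cs1 b1 hc1.le
    have e2 := cs1 b2 hc.le
    refine ⟨_, _, _, Nat.ceil_pos.2 (Real.exp_pos _),
      Nat.ceil_pos.2 (Real.exp_pos _), Nat.ceil_pos.2 (Real.exp_pos _), rate_aux ?_,
      rate_aux ?_, hn⟩
    · nlinarith
    · nlinarith



/-! ### Assembly of the parallel code -/

theorem bind_avg_dirac {ι X Y : Type*} [Fintype ι] [MeasurableSpace X] [MeasurableSingletonClass X]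
    [MeasurableSpace Y] (x : ι → X) (κ : X → Measure Y) :
    (avgM fun w => Measure.dirac (x w)).bind κ = avgM fun w => κ (x w) := by
  have h : AEMeasurable κ (avgM fun w => Measure.dirac (x w)) := by
    unfold avgM
    exact (aemeasurable_sum_measure_iff.2 fun i => aemeasurable_dirac).smul_measure _
  ext s hs
  rw [Measure.bind_apply hs h, lintegral_avgM, avgM_apply]
  simp

/-- exchange of the time and subchannel indices -/
def swp {n L : ℕ} (z : Fin L → Fin n → ℝ) : Fin n → Fin L → ℝ := fun i l => z l i

theorem measurable_swp {n L : ℕ} : Measurable (swp (n := n) (L := L)) := by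
  unfold swp; fun_prop

theorem parOut_swp {n L : ℕ} (g : Fin L → ℝ≥0) (x : Fin L → Fin n → ℝ) :
    parOut (fun l => (g l : ℝ)) (swp x) = (Measure.pi fun l => gLaw (g l) (x l)).map swp := by
  unfold parOut gLaw swp
  exact pi_swap_aux (fun (i : Fin n) (l : Fin L) => gaussianReal (√(g l : ℝ) * x l i) 1)

theorem jointLawPar_eq {n L K₁ K₂ : ℕ} (g : Fin L → ℝ)
    (enc : Fin K₁ × Fin K₂ → Measure (Fin n → Fin L → ℝ)) :
    jointLawPar g enc = jointM fun m => (enc m).bind (parOut g) := by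
  simp [jointLawPar, jointM, avgM]

theorem jointM_marg {A B Z : Type*} [Fintype A] [Fintype B] [MeasurableSpace A]
    [MeasurableSpace B] [MeasurableSpace Z] (V : A × B → Measure Z) [∀ m, IsProbabilityMeasure (V m)]
    [Nonempty B] :
    (jointM V).map (fun p => (p.1.1, p.2)) = jointM fun a => avgM fun b => V (a, b) := by
  rw [jointM, avgM_map _ _ (by fun_prop), jointM]
  have h1 : ∀ m : A × B, ((Measure.dirac m).prod (V m)).map (fun p => (p.1.1, p.2)) =
      (Measure.dirac m.1).prod (V m) := by
    intro m
    have := Measure.map_prod_map (Measure.dirac m) (V m) (measurable_fst (α := A) (β := B))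
      measurable_id
    rw [Measure.map_id, Measure.map_dirac' measurable_fst] at this
    rw [this]; rfl
  simp only [h1]
  rw [← avgM_prod (fun a b => (Measure.dirac a).prod (V (a, b)))]
  congr 1
  funext a
  ext s hs
  rw [avgM_apply, Measure.prod_apply hs, lintegral_dirac' _ (measurable_measure_prodMk_left hs),
    avgM_apply]
  congr 1
  refine Finset.sum_congr rfl fun b _ => ?_
  rw [Measure.prod_apply hs, lintegral_dirac' _ (measurable_measure_prodMk_left hs)]

/-- product of two families of finite types -/
def piPair {L : ℕ} {K1 K2 : Fin L → ℕ} {A B : Type*} (e1 : A ≃ ∀ l, Fin (K1 l))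
    (e2 : B ≃ ∀ l, Fin (K2 l)) : A × B ≃ ∀ l, Fin (K1 l) × Fin (K2 l) where
  toFun m l := (e1 m.1 l, e2 m.2 l)
  invFun f := (e1.symm fun l => (f l).1, e2.symm fun l => (f l).2)
  left_inv m := by simp
  right_inv f := by simp

theorem assemble {n L : ℕ} (a b1 b2 : Fin L → ℝ≥0) (P : Fin L → ℝ) (η : ℝ) (hη : 0 ≤ η)
    (K1 K2 W : Fin L → ℕ) (h1 : ∀ l, 0 < K1 l) (h2 : ∀ l, 0 < K2 l) (hW : ∀ l, 0 < W l)
    (hG : ∀ l, Good (a l) (b1 l) (b2 l) (P l) η n (K1 l) (K2 l) (W l)) :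
    ∃ enc : Fin (∏ l, K1 l) × Fin (∏ l, K2 l) → Measure (Fin n → Fin L → ℝ),
      (∀ m, IsProbabilityMeasure (enc m)) ∧
      (∀ m, enc m (perSubPow L P n) = 1) ∧
      ∃ dec : (Fin n → Fin L → ℝ) → Fin (∏ l, K1 l) × Fin (∏ l, K2 l), Measurable dec ∧
        (jointLawPar (fun l => (a l : ℝ)) enc {p | dec p.2 ≠ p.1}).toReal ≤ L * η ∧
        miBits (jointLawPar (fun l => (b2 l : ℝ)) enc) ≤
          (Real.log 2 + L * (n * η) + 1) / Real.log 2 ∧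
        miBits ((jointLawPar (fun l => (b1 l : ℝ)) enc).map fun p => (p.1.1, p.2)) ≤
          (Real.log 2 + L * (n * η) + 1) / Real.log 2 := by
  have hG' : ∀ l, ∃ c : Fin (K1 l) × Fin (K2 l) × Fin (W l) → (Fin n → ℝ), _ := fun l => hG l
  choose c hG' using hG'
  have hpow := fun l => (hG' l).1
  have hdec := fun l => (hG' l).2.1
  have hl2 := fun l => (hG' l).2.2.1
  have hl1 := fun l => (hG' l).2.2.2
  choose dec hdecm herr using hdec
  have : ∀ l, Nonempty (Fin (K1 l)) := fun l => ⟨⟨0, h1 l⟩⟩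
  have : ∀ l, Nonempty (Fin (K2 l)) := fun l => ⟨⟨0, h2 l⟩⟩
  have : ∀ l, Nonempty (Fin (W l)) := fun l => ⟨⟨0, hW l⟩⟩
  have : Nonempty (Fin (∏ l, K1 l)) := ⟨⟨0, Finset.prod_pos fun l _ => h1 l⟩⟩
  have : Nonempty (Fin (∏ l, K2 l)) := ⟨⟨0, Finset.prod_pos fun l _ => h2 l⟩⟩
  let e1 : Fin (∏ l, K1 l) ≃ ∀ l, Fin (K1 l) := finPiFinEquiv.symm
  let e2 : Fin (∏ l, K2 l) ≃ ∀ l, Fin (K2 l) := finPiFinEquiv.symm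
  let e := piPair e1 e2
  let enc : Fin (∏ l, K1 l) × Fin (∏ l, K2 l) → Measure (Fin n → Fin L → ℝ) := fun m =>
    avgM fun w : ∀ l, Fin (W l) =>
      Measure.dirac (swp fun l => c l (e1 m.1 l, e2 m.2 l, w l))
  let V0 (g : Fin L → ℝ≥0) (l : Fin L) (m : Fin (K1 l) × Fin (K2 l)) : Measure (Fin n → ℝ) :=
    avgM fun w : Fin (W l) => gLaw (g l) (c l (m.1, m.2, w))
  have hV0 : ∀ g l m, IsProbabilityMeasure (V0 g l m) := by
    intro g l m
    show IsProbabilityMeasure (avgM _); infer_instance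
  let V (g : Fin L → ℝ≥0) (m : Fin (∏ l, K1 l) × Fin (∏ l, K2 l)) :
      Measure (Fin n → Fin L → ℝ) := (Measure.pi fun l => V0 g l (e m l)).map swp
  have hVp : ∀ g m, IsProbabilityMeasure (V g m) := fun g m =>
    Measure.isProbabilityMeasure_map measurable_swp.aemeasurable
  have hV : ∀ (g : Fin L → ℝ≥0) m, (enc m).bind (parOut fun l => (g l : ℝ)) = V g m := by
    intro g m
    show (avgM fun w : ∀ l, Fin (W l) =>
      Measure.dirac (swp fun l => c l (e1 m.1 l, e2 m.2 l, w l))).bind _ = _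
    rw [bind_avg_dirac]
    simp only [parOut_swp]
    rw [← avgM_map _ _ measurable_swp,
      ← pi_avgM (fun l (w : Fin (W l)) => gLaw (g l) (c l (e1 m.1 l, e2 m.2 l, w)))]
    rfl
  have hJ : ∀ g : Fin L → ℝ≥0, jointLawPar (fun l => (g l : ℝ)) enc = jointM (V g) := by
    intro g; rw [jointLawPar_eq]; congr 1; funext m; exact hV g m
  have htop : (ENNReal.ofReal (Real.log 2) + ∑ _l : Fin L, ENNReal.ofReal (n * η)) ≠ ⊤ := by
    simp [ENNReal.mul_eq_top]
  have hl : 0 < Real.log 2 := Real.log_pos (by norm_num)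
  have htR : (ENNReal.ofReal (Real.log 2) + ∑ _l : Fin L, ENNReal.ofReal (n * η)).toReal =
      Real.log 2 + L * (n * η) := by
    rw [ENNReal.toReal_add ENNReal.ofReal_ne_top (ENNReal.sum_ne_top.2 fun _ _ => ENNReal.ofReal_ne_top),
      ENNReal.toReal_sum (fun _ _ => ENNReal.ofReal_ne_top), ENNReal.toReal_ofReal hl.le,
      ENNReal.toReal_ofReal (by positivity)]
    simp
  refine ⟨enc, fun m => ?_, fun m => ?_,
    fun y => e.symm fun l => dec l (fun i => y i l), ?_, ?_, ?_, ?_⟩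
  · show IsProbabilityMeasure (avgM _); infer_instance
  · show avgM _ _ = _
    rw [avgM_apply]
    have : ∀ w : ∀ l, Fin (W l), Measure.dirac (swp fun l => c l (e1 m.1 l, e2 m.2 l, w l))
        (perSubPow L P n) = 1 := by
      intro w
      exact Measure.dirac_apply_of_mem (fun l => hpow l _)
    simp only [this]
    exact card_inv_mul_sum_const 1
  · have : Measurable fun y : Fin n → Fin L → ℝ => (fun l => dec l (fun i => y i l)) := by
      refine measurable_pi_lambda _ fun l => (hdecm l).comp (by fun_prop)
    exact (measurable_of_finite (f := e.symm)).comp this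
  · have hDm : Measurable fun y : Fin n → Fin L → ℝ => e.symm fun l => dec l (fun i => y i l) := by
      have : Measurable fun y : Fin n → Fin L → ℝ => (fun l => dec l (fun i => y i l)) := by
        refine measurable_pi_lambda _ fun l => (hdecm l).comp (by fun_prop)
      exact (measurable_of_finite (f := e.symm)).comp this
    have hset : MeasurableSet {p : (Fin (∏ l, K1 l) × Fin (∏ l, K2 l)) × (Fin n → Fin L → ℝ) |
        (e.symm fun l => dec l (fun i => p.2 i l)) ≠ p.1} :=
      (measurableSet_eq_fun (hDm.comp measurable_snd) measurable_fst).compl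
    have hL : (L : ℝ) * η = ∑ _l : Fin L, η := by simp
    have hLe : ENNReal.ofReal (L * η) = ∑ _l : Fin L, ENNReal.ofReal η := by
      rw [hL, ENNReal.ofReal_sum_of_nonneg fun _ _ => hη]
    refine ENNReal.toReal_le_of_le_ofReal (by positivity) ?_
    rw [hJ a, hLe, jointM, avgM_apply]
    have hm : ∀ m, ((Measure.dirac m).prod (V a m)) {p |
        (e.symm fun l => dec l (fun i => p.2 i l)) ≠ p.1} ≤
        ∑ l, V0 a l (e m l) {z | dec l z ≠ e m l} := by
      intro m
      rw [Measure.prod_apply hset, lintegral_dirac' _ (measurable_measure_prodMk_left hset)]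
      show ((Measure.pi fun l => V0 a l (e m l)).map swp) _ ≤ _
      rw [Measure.map_apply measurable_swp (measurable_prodMk_left hset)]
      have hsub : swp ⁻¹' (Prod.mk m ⁻¹' {p : (Fin (∏ l, K1 l) × Fin (∏ l, K2 l)) ×
          (Fin n → Fin L → ℝ) | (e.symm fun l => dec l (fun i => p.2 i l)) ≠ p.1}) ⊆
          ⋃ l, (Function.eval l) ⁻¹' {z | dec l z ≠ e m l} := by
        intro z hz
        by_contra hcon
        apply hz
        show (e.symm fun l => dec l (z l)) = m
        rw [Equiv.symm_apply_eq]
        funext l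
        by_contra h
        exact hcon (Set.mem_iUnion.2 ⟨l, h⟩)
      refine (measure_mono hsub).trans ((measure_iUnion_fintype_le _ _).trans (le_of_eq ?_))
      refine Finset.sum_congr rfl fun l _ => ?_
      exact (measurePreserving_eval (fun l => V0 a l (e m l)) l).measure_preimage
        ((measurableSet_eq_fun (hdecm l) measurable_const).compl.nullMeasurableSet)
    refine (mul_le_mul_right (Finset.sum_le_sum fun m _ => hm m) _).trans ?_
    rw [Finset.sum_comm, Finset.mul_sum]
    refine Finset.sum_le_sum fun l _ => ?_
    rw [Fintype.card_congr e, Equiv.sum_comp e (fun m => V0 a l (m l) {z | dec l z ≠ m l}),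
      avg_coord_aux (κ := fun l => Fin (K1 l) × Fin (K2 l)) l
        (fun k => V0 a l k {z | dec l z ≠ k})]
    refine le_trans (le_of_eq ?_) (herr l)
    simp only [V0, avgM_apply, Fintype.sum_prod_type, Fintype.card_prod, Nat.cast_mul,
      ← Finset.mul_sum]
    rw [← mul_assoc, ← ENNReal.mul_inv (Or.inr (by simp)) (Or.inr (by simpa using (hW l).ne')), mul_assoc]
  · rw [hJ b2, ← htR]
    refine miBits_le_of_leak _ _ htop ?_
    have := ((Leak.pi (V := V0 b2) hl2).map swp swp measurable_swp measurable_swp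
      (fun z => rfl)).reindex e
    exact this
  · rw [hJ b1, jointM_marg, ← htR]
    refine miBits_le_of_leak _ _ htop ?_
    have := ((Leak.pi hl1).map swp swp measurable_swp measurable_swp
      (fun z => rfl)).reindex e1
    convert this using 2 with m
    show (avgM fun m2 => (Measure.pi fun l => V0 b1 l (e1 m l, e2 m2 l)).map swp) = _
    rw [← avgM_map _ _ measurable_swp]
    congr 1
    rw [avgM_equiv e2 (fun m2 => Measure.pi fun l => V0 b1 l (e1 m l, m2 l)),
      ← pi_avgM (fun l (m2 : Fin (K2 l)) => V0 b1 l (e1 m l, m2))]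
    congr 1
    funext l
    exact avgM_prod (fun m2 w => gLaw (b1 l) (c l (e1 m l, m2, w)))

theorem Cs_anti {P : ℝ} {a b1 b2 : ℝ≥0} (hP : 0 ≤ P) (hb : b2 ≤ b1) :
    Cs P a b1 ≤ Cs P a b2 := by
  rw [Cs_eq, Cs_eq]
  have := gG_mono hP hb
  have hl : 0 < Real.log 2 := Real.log_pos (by norm_num)
  exact max_le_max le_rfl (div_le_div_of_nonneg_right (by linarith) hl.le)

theorem rate_sum {n L : ℕ} (R : Fin L → ℝ) (K : Fin L → ℕ) (hK : ∀ l, 0 < K l) (η ε : ℝ)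
    (h : ∀ l, n * (R l - η) ≤ Real.logb 2 (K l)) (hε : L * η ≤ ε) :
    n * ((∑ l, R l) - ε) ≤ Real.logb 2 ((∏ l, K l : ℕ) : ℝ) := by
  have h1 : Real.logb 2 ((∏ l, K l : ℕ) : ℝ) = ∑ l, Real.logb 2 (K l) := by
    rw [Nat.cast_prod, Real.logb_prod]
    intro l _
    exact_mod_cast (hK l).ne'
  rw [h1]
  calc _ ≤ n * ((∑ l, R l) - L * η) := by gcongr
    _ = ∑ l, (n * (R l - η)) := by simp [← Finset.mul_sum, Finset.sum_sub_distrib]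
    _ ≤ _ := Finset.sum_le_sum fun l _ => h l

theorem main_aux (L : ℕ) (a b1 b2 : Fin L → ℝ≥0) (P : Fin L → ℝ) (hb : ∀ l, b2 l ≤ b1 l)
    (hP : ∀ l, 0 ≤ P l) :
    (∑ l, Cs (P l) (a l) (b1 l)) ≤ ∑ l, Cs (P l) (a l) (b2 l) ∧
    ParAchievable L (fun l => (a l : ℝ)) (fun l => (b1 l : ℝ)) (fun l => (b2 l : ℝ))
      (perSubPow L P) (∑ l, Cs (P l) (a l) (b1 l))
      ((∑ l, Cs (P l) (a l) (b2 l)) - ∑ l, Cs (P l) (a l) (b1 l)) := by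
  refine ⟨Finset.sum_le_sum fun l _ => Cs_anti (hP l) (hb l), ?_⟩
  intro ε hε
  have hl : 0 < Real.log 2 := Real.log_pos (by norm_num)
  have hl1 : Real.log 2 < 1 := by linarith [Real.log_two_lt_d9]
  set η := ε * Real.log 2 / (2 * (L + 1)) with hηd
  have hη : 0 < η := by positivity
  have hη2 : (L + 1) * η = ε * Real.log 2 / 2 := by rw [hηd]; field_simp
  have hη3 : L * η ≤ ε * Real.log 2 / 2 := by linarith
  have hLη : L * η ≤ ε := by nlinarith
  have hev := (Filter.eventually_all (ι := Fin L)).2 fun l =>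
    scalar_code (a l) (b1 l) (b2 l) (hb l) (P l) η (hP l) hη
  have hbig : ∀ᶠ n : ℕ in Filter.atTop, Real.log 2 + 1 ≤ n * (ε * Real.log 2 / 2) :=
    (Filter.Tendsto.atTop_mul_const (by positivity)
      tendsto_natCast_atTop_atTop).eventually_ge_atTop _
  obtain ⟨n, hn, hnb, hn0⟩ := (hev.and (hbig.and (Filter.eventually_gt_atTop 0))).exists
  choose K1 K2 W p1 p2 pW r1 r2 hG using hn
  obtain ⟨enc, q1, q2, dec, q3, q4, q5, q6⟩ :=
    assemble a b1 b2 P η hη.le K1 K2 W p1 p2 pW hG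
  have hfin : (Real.log 2 + L * (n * η) + 1) / Real.log 2 ≤ n * ε := by
    rw [div_le_iff₀ hl]
    have : (n : ℝ) * (L * η) ≤ n * (ε * Real.log 2 / 2) := by gcongr
    nlinarith
  refine ⟨n, hn0, ∏ l, K1 l, ∏ l, K2 l, Finset.prod_pos fun l _ => p1 l,
    Finset.prod_pos fun l _ => p2 l, rate_sum _ K1 p1 η ε r1 hLη, ?_,
    enc, q1, q2, dec, q3, q4.trans hLη, q5.trans hfin, q6.trans hfin⟩
  rw [← Finset.sum_sub_distrib]
  exact rate_sum _ K2 p2 η ε r2 hLη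

theorem final_aux (L : ℕ) (a b₁ b₂ P : Fin L → ℝ)
    (ha : ∀ l, 0 ≤ a l) (hb₁₂ : ∀ l, b₁ l ≥ b₂ l) (hb₂ : ∀ l, b₂ l ≥ 0)
    (hP : ∀ l, 0 ≤ P l) :
    (∑ l, Cs (P l) (a l) (b₁ l)) ≤ ∑ l, Cs (P l) (a l) (b₂ l) ∧
    ParAchievable L a b₁ b₂ (perSubPow L P)
      (∑ l, Cs (P l) (a l) (b₁ l))
      ((∑ l, Cs (P l) (a l) (b₂ l)) - ∑ l, Cs (P l) (a l) (b₁ l)) :=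
  main_aux L (fun l => ⟨a l, ha l⟩) (fun l => ⟨b₁ l, (hb₂ l).le.trans (hb₁₂ l)⟩)
    (fun l => ⟨b₂ l, hb₂ l⟩) P (fun l => hb₁₂ l) hP

/-- the corner point
`(∑ l, Cs(P l, a l, b₁ l), ∑ l, Cs(P l, a l, b₂ l) − ∑ l, Cs(P l, a l, b₁ l))` is
achievable for the independent parallel Gaussian two-level security wiretap channel under
the average individual per-subchannel power constraints; hence such channels are
perfectly embeddable. -/
theorem stmt9_parallel_gaussian_perfectly_embeddable (L : ℕ) (a b₁ b₂ P : Fin L → ℝ)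
    (ha : ∀ l, 0 ≤ a l) (hb₁₂ : ∀ l, b₁ l ≥ b₂ l) (hb₂ : ∀ l, b₂ l ≥ 0)
    (hP : ∀ l, 0 ≤ P l) :
    (∑ l, Cs (P l) (a l) (b₁ l)) ≤ ∑ l, Cs (P l) (a l) (b₂ l) ∧
    ParAchievable L a b₁ b₂ (perSubPow L P)
      (∑ l, Cs (P l) (a l) (b₁ l))
      ((∑ l, Cs (P l) (a l) (b₂ l)) - ∑ l, Cs (P l) (a l) (b₁ l)) := by
  exact final_aux L a b₁ b₂ P ha hb₁₂ hb₂ hP
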